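/- arXiv:2103.05523 — 4 statements merged into one kernel-verified Lean document; each statement's English description precedes it below -/
import Mathlib

section
/- Let A : ℝ^{n₁×n₂} → ℝ^m be a linear measurement operator, let X̂ ∈ ℝ^{n₁×n₂} admit a factorization X̂ = Û V̂ᵀ with Û ∈ ℝ^{n₁×R}, V̂ ∈ ℝ^{n₂×R}, let η ∈ ℝ^m and y = A(X̂) + η. Suppose the parameters α₁, α₂, β₁, β₂ > 0 satisfy α₁‖Û‖_F² ≤ ‖η‖₂²/2, α₂‖Û‖₁ ≤ ‖η‖₂²/2, β₁‖V̂‖_F² ≤ ‖η‖₂²/2 and β₂‖V̂‖₁ ≤ ‖η‖₂²/2. Then every global minimizer (U*, V*) of J satisfies ‖y − A(U* V*ᵀ)‖₂ ≤ 2‖η‖₂. -/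
open MeasureTheory ProbabilityTheory Filter Matrix Pointwise

noncomputable section

/-- Measurable space structure on matrices (entrywise product σ-algebra). -/
instance {m n α : Type*} [MeasurableSpace α] : MeasurableSpace (Matrix m n α) :=
  MeasurableSpace.pi (m := fun _ : m => MeasurableSpace.pi (m := fun _ : n => inferInstance))

/-- Frobenius inner product of two real matrices. -/
def frob {n₁ n₂ : ℕ} (A B : Matrix (Fin n₁) (Fin n₂) ℝ) : ℝ :=
  ∑ i, ∑ j, A i j * B i j

/-- Frobenius norm of a real matrix. -/
def frobNorm {n₁ n₂ : ℕ} (A : Matrix (Fin n₁) (Fin n₂) ℝ) : ℝ :=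
  Real.sqrt (∑ i, ∑ j, A i j ^ 2)

/-- Entrywise ℓ¹-norm of a real matrix. -/
def l1Norm {n₁ n₂ : ℕ} (A : Matrix (Fin n₁) (Fin n₂) ℝ) : ℝ :=
  ∑ i, ∑ j, |A i j|

/-- Euclidean (ℓ²) norm of a vector in ℝ^m. -/
def l2Norm {m : ℕ} (y : Fin m → ℝ) : ℝ :=
  Real.sqrt (∑ i, y i ^ 2)

/-- The linear measurement operator `A(Z)ᵢ = (1/√m)·⟨Aᵢ, Z⟩_F` determined by matrices `A i`. -/
def measOp {n₁ n₂ m : ℕ} (A : Fin m → Matrix (Fin n₁) (Fin n₂) ℝ)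
    (Z : Matrix (Fin n₁) (Fin n₂) ℝ) : Fin m → ℝ :=
  fun i => (1 / Real.sqrt m) * frob (A i) Z

/-- The multi-penalty functional
`J(U,V) = ‖y − A(UVᵀ)‖₂² + α₁‖U‖_F² + α₂‖U‖₁ + β₁‖V‖_F² + β₂‖V‖₁`. -/
def Jfun {n₁ n₂ m R : ℕ} (A : Fin m → Matrix (Fin n₁) (Fin n₂) ℝ) (y : Fin m → ℝ)
    (α₁ α₂ β₁ β₂ : ℝ) (U : Matrix (Fin n₁) (Fin R) ℝ) (V : Matrix (Fin n₂) (Fin R) ℝ) : ℝ :=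
  l2Norm (fun i => y i - measOp A (U * Vᵀ) i) ^ 2 + α₁ * frobNorm U ^ 2 + α₂ * l1Norm U
    + β₁ * frobNorm V ^ 2 + β₂ * l1Norm V

/-- The signal set `K_{s₁,s₂}^R` of matrices `Z = UVᵀ` with
`max{‖U‖_F², ‖V‖_F²} ≤ R`, `‖U‖₁ ≤ R√s₁`, `‖V‖₁ ≤ R√s₂`. -/
def Kset (n₁ n₂ : ℕ) (R : ℕ) (s₁ s₂ : ℝ) : Set (Matrix (Fin n₁) (Fin n₂) ℝ) :=
  {Z | ∃ (U : Matrix (Fin n₁) (Fin R) ℝ) (V : Matrix (Fin n₂) (Fin R) ℝ),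
    Z = U * Vᵀ ∧ max (frobNorm U ^ 2) (frobNorm V ^ 2) ≤ (R : ℝ) ∧
    l1Norm U ≤ (R : ℝ) * Real.sqrt s₁ ∧ l1Norm V ≤ (R : ℝ) * Real.sqrt s₂}

/-- Lemma: measurement misfit. If the regularization parameters are small
enough relative to the noise level and a factorization `X̂ = Û V̂ᵀ`, then every global minimizer
of `J` fits the measurements up to twice the noise level. -/
theorem measurement_misfit {n₁ n₂ m R : ℕ}
    (A : Fin m → Matrix (Fin n₁) (Fin n₂) ℝ)
    (Xhat : Matrix (Fin n₁) (Fin n₂) ℝ)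
    (Uhat : Matrix (Fin n₁) (Fin R) ℝ) (Vhat : Matrix (Fin n₂) (Fin R) ℝ)
    (η y : Fin m → ℝ)
    (hfac : Xhat = Uhat * Vhatᵀ)
    (hy : y = fun i => measOp A Xhat i + η i)
    (α₁ α₂ β₁ β₂ : ℝ) (hα₁ : 0 < α₁) (hα₂ : 0 < α₂) (hβ₁ : 0 < β₁) (hβ₂ : 0 < β₂)
    (h1 : α₁ * frobNorm Uhat ^ 2 ≤ l2Norm η ^ 2 / 2)
    (h2 : α₂ * l1Norm Uhat ≤ l2Norm η ^ 2 / 2)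
    (h3 : β₁ * frobNorm Vhat ^ 2 ≤ l2Norm η ^ 2 / 2)
    (h4 : β₂ * l1Norm Vhat ≤ l2Norm η ^ 2 / 2)
    (Ustar : Matrix (Fin n₁) (Fin R) ℝ) (Vstar : Matrix (Fin n₂) (Fin R) ℝ)
    (hmin : ∀ (U : Matrix (Fin n₁) (Fin R) ℝ) (V : Matrix (Fin n₂) (Fin R) ℝ),
      Jfun A y α₁ α₂ β₁ β₂ Ustar Vstar ≤ Jfun A y α₁ α₂ β₁ β₂ U V) :
    l2Norm (fun i => y i - measOp A (Ustar * Vstarᵀ) i) ≤ 2 * l2Norm η := by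
  have hres : (fun i => y i - measOp A (Uhat * Vhatᵀ) i) = η := by
    funext i
    simp [hy, hfac]
  have hJ := hmin Uhat Vhat
  unfold Jfun at hJ
  rw [hres] at hJ
  have hl1 : ∀ {p q : ℕ} (M : Matrix (Fin p) (Fin q) ℝ), 0 ≤ l1Norm M := fun M =>
    Finset.sum_nonneg fun i _ => Finset.sum_nonneg fun j _ => abs_nonneg (M i j)
  have hU₁ := mul_nonneg hα₁.le (sq_nonneg (frobNorm Ustar))
  have hU₂ := mul_nonneg hα₂.le (hl1 Ustar)
  have hV₁ := mul_nonneg hβ₁.le (sq_nonneg (frobNorm Vstar))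
  have hV₂ := mul_nonneg hβ₂.le (hl1 Vstar)
  have hη : 0 ≤ l2Norm η := Real.sqrt_nonneg _
  refine (pow_le_pow_iff_left₀ (show 0 ≤ l2Norm _ from Real.sqrt_nonneg _) (by positivity) two_ne_zero).mp ?_
  nlinarith [sq_nonneg (l2Norm η)]
end
end

section
/- Let Γ > 0 and assume X̂ ∈ Γ K_s^R generates the noisy measurements y = A(X̂) + η, and that the parameters satisfy α₁ = √(s/Γ)·α₂ = β₁ = √(s/Γ)·β₂ > 0. If (U*, V*) is a global minimizer of J with ‖y − A(U* V*ᵀ)‖₂ ≥ ‖η‖₂, then max{‖U*‖_F², ‖V*‖_F²} ≤ 4RΓ and max{‖U*‖₁, ‖V*‖₁} ≤ 4R√(Γs); in particular U* V*ᵀ ∈ Γ K_s^{4R}. -/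
open MeasureTheory ProbabilityTheory Filter Matrix Pointwise

noncomputable section

theorem frobNorm_sq {n₁ n₂ : ℕ} (A : Matrix (Fin n₁) (Fin n₂) ℝ) :
    frobNorm A ^ 2 = ∑ i, ∑ j, A i j ^ 2 :=
  Real.sq_sqrt (Finset.sum_nonneg fun _ _ => Finset.sum_nonneg fun _ _ => sq_nonneg _)

theorem l1Norm_nonneg {n₁ n₂ : ℕ} (A : Matrix (Fin n₁) (Fin n₂) ℝ) : 0 ≤ l1Norm A :=
  Finset.sum_nonneg fun _ _ => Finset.sum_nonneg fun _ _ => abs_nonneg _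

theorem frobNorm_smul_sq {n₁ n₂ : ℕ} (c : ℝ) (A : Matrix (Fin n₁) (Fin n₂) ℝ) :
    frobNorm (c • A) ^ 2 = c ^ 2 * frobNorm A ^ 2 := by
  simp only [frobNorm_sq, Matrix.smul_apply, smul_eq_mul, mul_pow, Finset.mul_sum]

theorem l1Norm_smul {n₁ n₂ : ℕ} {c : ℝ} (hc : 0 ≤ c) (A : Matrix (Fin n₁) (Fin n₂) ℝ) :
    l1Norm (c • A) = c * l1Norm A := by
  simp only [l1Norm, Matrix.smul_apply, smul_eq_mul, abs_mul, abs_of_nonneg hc, Finset.mul_sum]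

/-- Append zero columns to a matrix (or truncate it) so that it has `N` columns. -/
def padCols {n R : ℕ} (N : ℕ) (U : Matrix (Fin n) (Fin R) ℝ) : Matrix (Fin n) (Fin N) ℝ :=
  fun i j => if h : (j : ℕ) < R then U i ⟨j, h⟩ else 0

theorem sum_eq_of_zero_extension {R N : ℕ} (hRN : R ≤ N) {U : Fin R → ℝ} {W : Fin N → ℝ}
    (hW : ∀ j : Fin N, W j = if h : (j : ℕ) < R then U ⟨j, h⟩ else 0) :
    ∑ j, W j = ∑ j, U j := by
  obtain ⟨k, rfl⟩ := Nat.exists_eq_add_of_le hRN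
  simp [Fin.sum_univ_add, hW]

theorem frobNorm_padCols {n R N : ℕ} (hRN : R ≤ N) (U : Matrix (Fin n) (Fin R) ℝ) :
    frobNorm (padCols N U) = frobNorm U := by
  unfold frobNorm
  congr 1
  refine Finset.sum_congr rfl fun i _ => sum_eq_of_zero_extension hRN fun j => ?_
  unfold padCols
  split_ifs <;> simp

theorem l1Norm_padCols {n R N : ℕ} (hRN : R ≤ N) (U : Matrix (Fin n) (Fin R) ℝ) :
    l1Norm (padCols N U) = l1Norm U := by
  refine Finset.sum_congr rfl fun i _ => sum_eq_of_zero_extension hRN fun j => ?_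
  unfold padCols
  split_ifs <;> simp

theorem padCols_mul_transpose {n₁ n₂ R N : ℕ} (hRN : R ≤ N)
    (U : Matrix (Fin n₁) (Fin R) ℝ) (V : Matrix (Fin n₂) (Fin R) ℝ) :
    padCols N U * (padCols N V)ᵀ = U * Vᵀ := by
  ext i k
  simp only [Matrix.mul_apply, Matrix.transpose_apply]
  refine sum_eq_of_zero_extension hRN fun j => ?_
  unfold padCols
  split_ifs <;> simp

theorem sqrt_smul_mul_transpose {n₁ n₂ R : ℕ} {c : ℝ} (hc : 0 ≤ c)
    (U : Matrix (Fin n₁) (Fin R) ℝ) (V : Matrix (Fin n₂) (Fin R) ℝ) :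
    (Real.sqrt c • U) * (Real.sqrt c • V)ᵀ = c • (U * Vᵀ) := by
  rw [Matrix.transpose_smul, Matrix.smul_mul, Matrix.mul_smul, smul_smul, Real.mul_self_sqrt hc]

/-- Bounds on the factors of `U * Vᵀ` give membership in a scaled signal set, possibly with a
larger number of columns. -/
theorem mul_transpose_mem_smul_Kset {n₁ n₂ R N : ℕ} {Γ s₁ s₂ : ℝ} (hΓ : 0 < Γ) (hRN : R ≤ N)
    {U : Matrix (Fin n₁) (Fin R) ℝ} {V : Matrix (Fin n₂) (Fin R) ℝ}
    (hUF : frobNorm U ^ 2 ≤ N * Γ) (hVF : frobNorm V ^ 2 ≤ N * Γ)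
    (hU1 : l1Norm U ≤ N * Real.sqrt (Γ * s₁)) (hV1 : l1Norm V ≤ N * Real.sqrt (Γ * s₂)) :
    U * Vᵀ ∈ Γ • Kset n₁ n₂ N s₁ s₂ := by
  have hinv : 0 ≤ Γ⁻¹ := (inv_pos.2 hΓ).le
  have frob_le : ∀ {n : ℕ} {W : Matrix (Fin n) (Fin R) ℝ}, frobNorm W ^ 2 ≤ N * Γ →
      frobNorm (padCols N (Real.sqrt Γ⁻¹ • W)) ^ 2 ≤ N := by
    intro n W hW
    rw [frobNorm_padCols hRN, frobNorm_smul_sq, Real.sq_sqrt hinv, inv_mul_le_iff₀ hΓ]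
    linarith
  have l1_le : ∀ {n : ℕ} {t : ℝ} {W : Matrix (Fin n) (Fin R) ℝ},
      l1Norm W ≤ N * Real.sqrt (Γ * t) →
      l1Norm (padCols N (Real.sqrt Γ⁻¹ • W)) ≤ N * Real.sqrt t := by
    intro n t W hW
    rw [l1Norm_padCols hRN, l1Norm_smul (Real.sqrt_nonneg _), Real.sqrt_inv,
      inv_mul_le_iff₀ (Real.sqrt_pos.2 hΓ)]
    rw [Real.sqrt_mul hΓ.le] at hW
    linarith
  refine Set.mem_smul_set.2 ⟨Γ⁻¹ • (U * Vᵀ), ⟨padCols N (Real.sqrt Γ⁻¹ • U),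
    padCols N (Real.sqrt Γ⁻¹ • V), ?_, max_le (frob_le hUF) (frob_le hVF), l1_le hU1, l1_le hV1⟩,
    smul_inv_smul₀ hΓ.ne' _⟩
  rw [padCols_mul_transpose hRN, sqrt_smul_mul_transpose hinv]

/-- Lemma: regularity. If `X̂ ∈ Γ K_s^R`, the parameters satisfy
`α₁ = √(s/Γ)·α₂ = β₁ = √(s/Γ)·β₂ > 0` and a global minimizer does not overfit, then its
components are controlled and `U* V*ᵀ ∈ Γ K_s^{4R}`. -/
theorem regularity_of_minimizers {n₁ n₂ m R : ℕ} (Γ s : ℝ) (hΓ : 0 < Γ) (hs : 0 < s)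
    (A : Fin m → Matrix (Fin n₁) (Fin n₂) ℝ)
    (Xhat : Matrix (Fin n₁) (Fin n₂) ℝ)
    (hXhat : Xhat ∈ Γ • Kset n₁ n₂ R s s)
    (η y : Fin m → ℝ)
    (hy : y = fun i => measOp A Xhat i + η i)
    (α₁ α₂ β₁ β₂ : ℝ)
    (hα₁ : 0 < α₁)
    (hr1 : α₁ = Real.sqrt (s / Γ) * α₂)
    (hr2 : α₁ = β₁)
    (hr3 : β₁ = Real.sqrt (s / Γ) * β₂)
    (Ustar : Matrix (Fin n₁) (Fin R) ℝ) (Vstar : Matrix (Fin n₂) (Fin R) ℝ)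
    (hmin : ∀ (U : Matrix (Fin n₁) (Fin R) ℝ) (V : Matrix (Fin n₂) (Fin R) ℝ),
      Jfun A y α₁ α₂ β₁ β₂ Ustar Vstar ≤ Jfun A y α₁ α₂ β₁ β₂ U V)
    (hfit : l2Norm η ≤ l2Norm (fun i => y i - measOp A (Ustar * Vstarᵀ) i)) :
    (max (frobNorm Ustar ^ 2) (frobNorm Vstar ^ 2) ≤ 4 * R * Γ ∧
      max (l1Norm Ustar) (l1Norm Vstar) ≤ 4 * R * Real.sqrt (Γ * s)) ∧
    Ustar * Vstarᵀ ∈ Γ • Kset n₁ n₂ (4 * R) s s := by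
  obtain ⟨Z, ⟨U, V, rfl, hF, hU1, hV1⟩, rfl⟩ := Set.mem_smul_set.1 hXhat
  obtain ⟨hUF, hVF⟩ := max_le_iff.1 hF
  subst hr2
  have hα₂ : 0 < α₂ := pos_of_mul_pos_right (hr1 ▸ hα₁) (Real.sqrt_nonneg _)
  have hβ₂ : β₂ = α₂ := by
    have hne : Real.sqrt (s / Γ) ≠ 0 := (Real.sqrt_pos.2 (div_pos hs hΓ)).ne'
    exact mul_left_cancel₀ hne (hr3.symm.trans hr1)
  subst hβ₂
  have hscale : α₁ * Γ = β₂ * Real.sqrt (Γ * s) := by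
    rw [hr1, Real.sqrt_div hs.le, Real.sqrt_mul hΓ.le]
    have hne : Real.sqrt Γ ≠ 0 := (Real.sqrt_pos.2 hΓ).ne'
    have hsq : Real.sqrt Γ ^ 2 = Γ := Real.sq_sqrt hΓ.le
    field_simp
    rw [hsq]
  have hJ := hmin (Real.sqrt Γ • U) (Real.sqrt Γ • V)
  have hres : (fun i => y i - measOp A ((Real.sqrt Γ • U) * (Real.sqrt Γ • V)ᵀ) i) = η := by
    funext i
    rw [sqrt_smul_mul_transpose hΓ.le, hy]
    simp
  unfold Jfun at hJ
  rw [hres] at hJ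
  simp only [frobNorm_smul_sq, l1Norm_smul (Real.sqrt_nonneg _), Real.sq_sqrt hΓ.le] at hJ
  have hη : 0 ≤ l2Norm η := Real.sqrt_nonneg _
  have hfit2 := pow_le_pow_left₀ hη hfit 2
  have frob_le : ∀ {n : ℕ} {W : Matrix (Fin n) (Fin R) ℝ}, frobNorm W ^ 2 ≤ R →
      α₁ * (Γ * frobNorm W ^ 2) ≤ R * (α₁ * Γ) := by
    intro n W hW
    calc α₁ * (Γ * frobNorm W ^ 2) ≤ α₁ * (Γ * R) := by gcongr
      _ = R * (α₁ * Γ) := by ring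
  have l1_le : ∀ {n : ℕ} {W : Matrix (Fin n) (Fin R) ℝ}, l1Norm W ≤ R * Real.sqrt s →
      β₂ * (Real.sqrt Γ * l1Norm W) ≤ R * (α₁ * Γ) := by
    intro n W hW
    calc β₂ * (Real.sqrt Γ * l1Norm W) ≤ β₂ * (Real.sqrt Γ * (R * Real.sqrt s)) := by gcongr
      _ = R * (α₁ * Γ) := by rw [hscale, Real.sqrt_mul hΓ.le]; ring
  have hUF' := frob_le hUF
  have hVF' := frob_le hVF
  have hU1' := l1_le hU1
  have hV1' := l1_le hV1
  have pUF : 0 ≤ α₁ * frobNorm Ustar ^ 2 := by positivity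
  have pVF : 0 ≤ α₁ * frobNorm Vstar ^ 2 := by positivity
  have pU1 : 0 ≤ β₂ * l1Norm Ustar := mul_nonneg hα₂.le (l1Norm_nonneg _)
  have pV1 : 0 ≤ β₂ * l1Norm Vstar := mul_nonneg hα₂.le (l1Norm_nonneg _)
  have bUF : frobNorm Ustar ^ 2 ≤ 4 * R * Γ := le_of_mul_le_mul_left (by linarith) hα₁
  have bVF : frobNorm Vstar ^ 2 ≤ 4 * R * Γ := le_of_mul_le_mul_left (by linarith) hα₁
  have hbound : β₂ * (4 * R * Real.sqrt (Γ * s)) = 4 * (R * (α₁ * Γ)) := by rw [hscale]; ring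
  have bU1 : l1Norm Ustar ≤ 4 * R * Real.sqrt (Γ * s) :=
    le_of_mul_le_mul_left (by linarith) hα₂
  have bV1 : l1Norm Vstar ≤ 4 * R * Real.sqrt (Γ * s) :=
    le_of_mul_le_mul_left (by linarith) hα₂
  refine ⟨⟨max_le bUF bVF, max_le bU1 bV1⟩, ?_⟩
  apply mul_transpose_mem_smul_Kset hΓ (by omega : R ≤ 4 * R) <;> push_cast <;> assumption
end
end

section
/- There is an absolute constant C > 0 with the following property. Let Γ > 0, R ∈ ℕ, and 1 ≤ s₁ ≤ n₁, 1 ≤ s₂ ≤ n₂. Then for every ε ∈ (0,1), the covering number of Γ K_{s₁,s₂}^R in the Frobenius norm satisfies log N(Γ K_{s₁,s₂}^R, ‖·‖_F, ε) ≤ C · ε⁻² · Γ² R³ (s₁ + s₂) · log(max{e n₁/s₁, e n₂/s₂}). -/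
open MeasureTheory ProbabilityTheory Filter Matrix Pointwise

noncomputable section

/-- The covering number `N(K, d, ε)`: the minimal cardinality of a finite set `T` such that
every point of `K` is within distance `< ε` of some point of `T` (with value `⊤` if no finite
covering exists). -/
def coveringNumber {X : Type*} (K : Set X) (d : X → X → ℝ) (ε : ℝ) : ℕ∞ :=
  sInf {n : ℕ∞ | ∃ T : Finset X, (T.card : ℕ∞) = n ∧ ∀ z ∈ K, ∃ t ∈ T, d z t < ε}

/-- The vertices `±r eᵢ` of the `ℓ¹`-ball of radius `r`. -/
def l1Vertex {ι : Type*} [DecidableEq ι] (r : ℝ) (a : ι × Bool) : ι → ℝ :=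
  Pi.single a.1 (if a.2 then r else -r)

lemma sum_abs_l1Vertex {ι : Type*} [Fintype ι] [DecidableEq ι] {r : ℝ} (hr : 0 ≤ r)
    (a : ι × Bool) : ∑ i, |l1Vertex r a i| = r := by
  rw [Finset.sum_eq_single a.1]
  · simp only [l1Vertex, Pi.single_eq_same]
    split_ifs <;> simp [abs_of_nonneg hr]
  · intro b _ hb
    simp [l1Vertex, hb]
  · simp

/-- A linear functional on the `ℓ¹`-ball is minimized at a vertex. -/
lemma exists_l1Vertex_sum_mul_le {ι : Type*} [Fintype ι] [DecidableEq ι] [Nonempty ι] {r : ℝ}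
    (x w : ι → ℝ) (hx : ∑ i, |x i| ≤ r) :
    ∃ a : ι × Bool, ∑ i, l1Vertex r a i * w i ≤ ∑ i, x i * w i := by
  obtain ⟨j, hj⟩ := Finite.exists_max (fun i => |w i|)
  have key : -(r * |w j|) ≤ ∑ i, x i * w i := by
    have h1 : |∑ i, x i * w i| ≤ r * |w j| := by
      calc |∑ i, x i * w i| ≤ ∑ i, |x i * w i| := Finset.abs_sum_le_sum_abs _ _
        _ ≤ ∑ i, |x i| * |w j| := Finset.sum_le_sum fun i _ => by
            rw [abs_mul]; exact mul_le_mul_of_nonneg_left (hj i) (abs_nonneg _)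
        _ = (∑ i, |x i|) * |w j| := by rw [Finset.sum_mul]
        _ ≤ r * |w j| := mul_le_mul_of_nonneg_right hx (abs_nonneg _)
    exact (abs_le.mp h1).1
  have hsum (b : Bool) : ∑ i, l1Vertex r (j, b) i * w i = (if b then r else -r) * w j := by
    rw [Finset.sum_eq_single j]
    · simp [l1Vertex]
    · intro b _ hb
      simp [l1Vertex, hb]
    · simp
  rcases le_total 0 (w j) with h | h
  · refine ⟨(j, false), ?_⟩
    rw [hsum]
    rw [abs_of_nonneg h] at key
    simpa using key
  · refine ⟨(j, true), ?_⟩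
    rw [hsum]
    rw [abs_of_nonpos h] at key
    simpa using key

/-- A greedy version of Maurey's empirical method: every point of the `ℓ¹`-ball of radius `r` is
approximated by an average of `m` vertices, with Euclidean error at most `2 * r / √m`. -/
lemma exists_sym_sum_sq_sub_le {ι : Type*} [Fintype ι] [DecidableEq ι] [Nonempty ι] {r : ℝ}
    (x : ι → ℝ) (hx : ∑ i, |x i| ≤ r) (m : ℕ) :
    ∃ s : Sym (ι × Bool) m,
      ∑ i, (((s : Multiset (ι × Bool)).map (l1Vertex r)).sum i - m * x i) ^ 2 ≤ 4 * r ^ 2 * m := by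
  have hr : 0 ≤ r := (Finset.sum_nonneg fun i _ => abs_nonneg (x i)).trans hx
  induction m with
  | zero => exact ⟨Sym.nil, by simp⟩
  | succ m ih =>
    obtain ⟨s, hs⟩ := ih
    set S : ι → ℝ := fun i => ((s : Multiset (ι × Bool)).map (l1Vertex r)).sum i - m * x i with hS
    obtain ⟨a, ha⟩ := exists_l1Vertex_sum_mul_le x S hx
    refine ⟨a ::ₛ s, ?_⟩
    have hd : ∑ i, (l1Vertex r a i - x i) ^ 2 ≤ 4 * r ^ 2 := by
      have h1 : ∑ i, |l1Vertex r a i - x i| ≤ 2 * r := by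
        calc ∑ i, |l1Vertex r a i - x i| ≤ ∑ i, (|l1Vertex r a i| + |x i|) :=
              Finset.sum_le_sum fun i _ => abs_sub _ _
          _ = r + ∑ i, |x i| := by rw [Finset.sum_add_distrib, sum_abs_l1Vertex hr]
          _ ≤ 2 * r := by linarith
      calc ∑ i, (l1Vertex r a i - x i) ^ 2 = ∑ i, |l1Vertex r a i - x i| ^ 2 := by simp
        _ ≤ (∑ i, |l1Vertex r a i - x i|) ^ 2 :=
            Finset.sum_sq_le_sq_sum_of_nonneg fun i _ => abs_nonneg _
        _ ≤ (2 * r) ^ 2 := by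
            gcongr
        _ = 4 * r ^ 2 := by ring
    have hexp : ∑ i, ((((a ::ₛ s : Sym (ι × Bool) (m + 1)) : Multiset (ι × Bool)).map
          (l1Vertex r)).sum i - ((m + 1 : ℕ) : ℝ) * x i) ^ 2
        = ∑ i, S i ^ 2 + 2 * (∑ i, l1Vertex r a i * S i - ∑ i, x i * S i)
          + ∑ i, (l1Vertex r a i - x i) ^ 2 := by
      rw [← Finset.sum_sub_distrib, Finset.mul_sum, ← Finset.sum_add_distrib,
        ← Finset.sum_add_distrib]
      refine Finset.sum_congr rfl fun i _ => ?_
      simp only [Sym.coe_cons, Multiset.map_cons, Multiset.sum_cons, Pi.add_apply, hS]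
      push_cast
      ring
    rw [hexp]
    push_cast
    linarith

lemma log_choose_le {a m : ℕ} (hm : 0 < m) (ham : 0 < a) :
    Real.log ((a + m - 1).choose m) ≤ m * (1 + Real.log (1 + a / m)) := by
  have hm' : (0 : ℝ) < m := by exact_mod_cast hm
  have hpos : 0 < (a + m - 1).choose m := Nat.choose_pos (by omega)
  have h1 : (((a + m - 1).choose m : ℕ) : ℝ) ≤ ((a + m : ℕ) : ℝ) ^ m / m.factorial := by
    refine (Nat.choose_le_pow_div m (a + m - 1)).trans ?_
    gcongr
    omega
  have h2 : (m : ℝ) ^ m / m.factorial ≤ Real.exp m := Real.pow_div_factorial_le_exp _ hm'.le m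
  have h3 : ((a + m : ℕ) : ℝ) ^ m / m.factorial
      = (1 + (a : ℝ) / m) ^ m * ((m : ℝ) ^ m / m.factorial) := by
    rw [← mul_div_assoc, ← mul_pow]
    congr 2
    push_cast
    field_simp
    ring
  have hq : (0 : ℝ) < 1 + a / m := by positivity
  calc Real.log ((a + m - 1).choose m)
      ≤ Real.log ((1 + (a : ℝ) / m) ^ m * Real.exp m) := by
        apply Real.log_le_log (by exact_mod_cast hpos)
        refine h1.trans (h3.le.trans ?_)
        gcongr
    _ = m * (1 + Real.log (1 + a / m)) := by
        rw [Real.log_mul (by positivity) (by positivity), Real.log_pow, Real.log_exp]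
        ring

/-- Covering an `ℓ¹`-ball of matrices by averages of `m` vertices. -/
lemma exists_finset_frobNorm_sub_le {n R m : ℕ} (hn : 0 < n) (hR : 0 < R) (hm : 0 < m) (r : ℝ) :
    ∃ T : Finset (Matrix (Fin n) (Fin R) ℝ), T.card ≤ (2 * (n * R) + m - 1).choose m ∧
      ∀ U, l1Norm U ≤ r → ∃ U' ∈ T, frobNorm (U - U') ≤ 2 * r / Real.sqrt m := by
  have : Nonempty (Fin n) := ⟨⟨0, hn⟩⟩
  have : Nonempty (Fin R) := ⟨⟨0, hR⟩⟩
  have hm' : (0 : ℝ) < m := by exact_mod_cast hm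
  classical
  let f : Sym ((Fin n × Fin R) × Bool) m → Matrix (Fin n) (Fin R) ℝ := fun s =>
    Matrix.of fun i j =>
      (m : ℝ)⁻¹ * ((s : Multiset ((Fin n × Fin R) × Bool)).map (l1Vertex r)).sum (i, j)
  refine ⟨Finset.univ.image f, ?_, ?_⟩
  · refine Finset.card_image_le.trans ?_
    rw [Finset.card_univ, Sym.card_sym_eq_choose]
    simp [mul_comm]
  · intro U hU
    have hU' : ∑ p : Fin n × Fin R, |U p.1 p.2| ≤ r := by
      rw [Fintype.sum_prod_type]; exact hU
    have hr : 0 ≤ r := (Finset.sum_nonneg fun i _ => abs_nonneg _).trans hU'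
    obtain ⟨s, hs⟩ := exists_sym_sum_sq_sub_le (fun p : Fin n × Fin R => U p.1 p.2) hU' m
    refine ⟨f s, Finset.mem_image_of_mem f (Finset.mem_univ s), ?_⟩
    refine Real.sqrt_le_iff.mpr ⟨by positivity, ?_⟩
    have heq : ∑ i, ∑ j, (U - f s) i j ^ 2 = (m : ℝ)⁻¹ ^ 2 * ∑ p : Fin n × Fin R,
        (((s : Multiset _).map (l1Vertex r)).sum p - m * U p.1 p.2) ^ 2 := by
      rw [Fintype.sum_prod_type, Finset.mul_sum]
      refine Finset.sum_congr rfl fun i _ => ?_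
      rw [Finset.mul_sum]
      refine Finset.sum_congr rfl fun j _ => ?_
      simp only [Matrix.sub_apply, f, Matrix.of_apply]
      field_simp
      ring
    rw [heq, div_pow, Real.sq_sqrt hm'.le]
    calc _ ≤ (m : ℝ)⁻¹ ^ 2 * (4 * r ^ 2 * m) := by gcongr
      _ = _ := by field_simp; ring

/-- Covering the matrices with `‖U‖₁ ≤ R√s` at scale `η√R`. -/
lemma exists_finset_log_card_le {n R : ℕ} {s η : ℝ} (hR : 0 < R) (hs : 1 ≤ s) (hsn : s ≤ n)
    (hη : 0 < η) (hη1 : η ≤ 1) :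
    ∃ T : Finset (Matrix (Fin n) (Fin R) ℝ),
      Real.log T.card ≤ 24 * (R * s / η ^ 2) * Real.log (Real.exp 1 * n / s) ∧
      ∀ U, l1Norm U ≤ R * Real.sqrt s → ∃ U' ∈ T, frobNorm (U - U') ≤ η * Real.sqrt R := by
  have hR1 : (1 : ℝ) ≤ R := by exact_mod_cast hR
  have hs0 : 0 < s := by linarith
  have hn0 : (0 : ℝ) < n := by linarith
  have hn : 0 < n := by exact_mod_cast hn0
  set k : ℝ := R * s / η ^ 2 with hk
  have hη2 : η ^ 2 ≤ 1 := pow_le_one₀ hη.le hη1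
  have hkR : R * s ≤ k := by
    rw [hk, le_div_iff₀ (by positivity)]
    exact mul_le_of_le_one_right (by positivity) hη2
  have hk1 : 1 ≤ k := le_trans (by nlinarith) hkR
  set m : ℕ := ⌈4 * k⌉₊ with hmdef
  have hmk : 4 * k ≤ m := Nat.le_ceil _
  have hmk' : (m : ℝ) ≤ 8 * k := by
    have := Nat.ceil_lt_add_one (show 0 ≤ 4 * k by positivity)
    linarith
  have hm' : (0 : ℝ) < m := by linarith
  have hm : 0 < m := by exact_mod_cast hm'
  obtain ⟨T, hT, hcov⟩ := exists_finset_frobNorm_sub_le hn hR hm (R * Real.sqrt s)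
  refine ⟨T, ?_, fun U hU => ?_⟩
  · have hL : Real.log (Real.exp 1 * n / s) = 1 + Real.log (n / s) := by
      rw [mul_div_assoc, Real.log_mul (by positivity) (by positivity), Real.log_exp]
    have hq : 1 ≤ (n : ℝ) / s := (one_le_div hs0).mpr hsn
    have hq0 : 0 ≤ Real.log (n / s) := Real.log_nonneg hq
    have h1 : Real.log T.card ≤ m * (1 + Real.log (1 + (2 * (n * R) : ℕ) / m)) := by
      refine le_trans ?_ (log_choose_le (a := 2 * (n * R)) hm (by positivity))
      rcases Nat.eq_zero_or_pos T.card with h | h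
      · rw [h]
        simpa using Real.log_natCast_nonneg _
      · exact Real.log_le_log (by exact_mod_cast h) (by exact_mod_cast hT)
    have h2 : 1 + ((2 * (n * R) : ℕ) : ℝ) / m ≤ 3 * (n / s) := by
      have : ((2 * (n * R) : ℕ) : ℝ) / m ≤ 2 * (n / s) := by
        rw [div_le_iff₀ hm']
        push_cast
        have : (2 : ℝ) * (n * R) = 2 * (n / s) * (R * s) := by field_simp
        rw [this]
        gcongr
        linarith
      linarith
    have h3 : Real.log (1 + ((2 * (n * R) : ℕ) : ℝ) / m) ≤ 2 + Real.log (n / s) := by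
      refine (Real.log_le_log (by positivity) h2).trans ?_
      rw [Real.log_mul (by norm_num) (by positivity)]
      have := Real.log_le_sub_one_of_pos (show (0 : ℝ) < 3 by norm_num)
      linarith
    rw [hL]
    calc Real.log T.card ≤ m * (1 + Real.log (1 + (2 * (n * R) : ℕ) / m)) := h1
      _ ≤ (8 * k) * (3 * (1 + Real.log (n / s))) := by
          refine mul_le_mul hmk' (by linarith) ?_ (by positivity)
          have := Real.log_nonneg (show (1 : ℝ) ≤ 1 + ((2 * (n * R) : ℕ) : ℝ) / m by
            have : (0 : ℝ) ≤ ((2 * (n * R) : ℕ) : ℝ) / m := by positivity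
            linarith)
          linarith
      _ = 24 * k * (1 + Real.log (n / s)) := by ring
  · obtain ⟨U', hU', h⟩ := hcov U hU
    refine ⟨U', hU', h.trans ?_⟩
    rw [div_le_iff₀ (by positivity)]
    apply (pow_le_pow_iff_left₀ (by positivity) (by positivity) two_ne_zero).mp
    simp only [mul_pow]
    rw [Real.sq_sqrt hs0.le, Real.sq_sqrt hm'.le, Real.sq_sqrt (by positivity)]
    have : (2 : ℝ) ^ 2 * (R ^ 2 * s) = η ^ 2 * R * (4 * k) := by
      rw [hk]; field_simp; norm_num
    rw [this]
    gcongr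

section Frobenius

attribute [local instance] Matrix.frobeniusNormedAddCommGroup Matrix.frobeniusNormedSpace

lemma frobNorm_eq_norm {n₁ n₂ : ℕ} (A : Matrix (Fin n₁) (Fin n₂) ℝ) : frobNorm A = ‖A‖ := by
  rw [Matrix.frobenius_norm_def, frobNorm, Real.sqrt_eq_rpow]
  simp

lemma frobNorm_smul {n₁ n₂ : ℕ} (c : ℝ) (A : Matrix (Fin n₁) (Fin n₂) ℝ) :
    frobNorm (c • A) = |c| * frobNorm A := by
  rw [frobNorm_eq_norm, frobNorm_eq_norm, norm_smul, Real.norm_eq_abs]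

lemma frobNorm_mul_transpose_le {n₁ n₂ R : ℕ} (U : Matrix (Fin n₁) (Fin R) ℝ)
    (V : Matrix (Fin n₂) (Fin R) ℝ) : frobNorm (U * Vᵀ) ≤ frobNorm U * frobNorm V := by
  simp only [frobNorm_eq_norm]
  exact (Matrix.frobenius_norm_mul U Vᵀ).trans_eq (by rw [Matrix.frobenius_norm_transpose])

lemma frobNorm_mul_transpose_sub_le {n₁ n₂ R : ℕ} (U U' : Matrix (Fin n₁) (Fin R) ℝ)
    (V V' : Matrix (Fin n₂) (Fin R) ℝ) :
    frobNorm (U * Vᵀ - U' * V'ᵀ) ≤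
      frobNorm (U - U') * frobNorm V
        + (frobNorm U + frobNorm (U - U')) * frobNorm (V - V') := by
  have h : U * Vᵀ - U' * V'ᵀ = (U - U') * Vᵀ + U' * (V - V')ᵀ := by
    rw [Matrix.transpose_sub, Matrix.sub_mul, Matrix.mul_sub]
    abel
  have h1 := frobNorm_mul_transpose_le (U - U') V
  have h2 := frobNorm_mul_transpose_le U' (V - V')
  rw [h]
  simp only [frobNorm_eq_norm] at *
  have h3 : ‖U'‖ ≤ ‖U‖ + ‖U - U'‖ := by
    have := norm_sub_le U (U - U')
    rwa [sub_sub_cancel] at this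
  calc _ ≤ ‖(U - U') * Vᵀ‖ + ‖U' * (V - V')ᵀ‖ := norm_add_le _ _
    _ ≤ ‖U - U'‖ * ‖V‖ + ‖U'‖ * ‖V - V'‖ := add_le_add h1 h2
    _ ≤ _ := by gcongr

end Frobenius

/-- A finite cover bounds the covering number. -/
lemma coveringNumber_ne_top_and_log_le {X : Type*} {K : Set X} {d : X → X → ℝ} {ε : ℝ}
    (T : Finset X) (hT : ∀ z ∈ K, ∃ t ∈ T, d z t < ε) :
    coveringNumber K d ε ≠ ⊤ ∧
      Real.log ((coveringNumber K d ε).toNat : ℝ) ≤ Real.log (T.card : ℝ) := by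
  have h : coveringNumber K d ε ≤ (T.card : ℕ∞) := sInf_le ⟨T, rfl, hT⟩
  refine ⟨ne_top_of_le_ne_top (ENat.natCast_ne_top _) h, ?_⟩
  have h' : (coveringNumber K d ε).toNat ≤ T.card := ENat.toNat_le_of_le_natCast h
  rcases Nat.eq_zero_or_pos (coveringNumber K d ε).toNat with h0 | h0
  · rw [h0]
    simpa using Real.log_natCast_nonneg _
  · exact Real.log_le_log (by exact_mod_cast h0) (by exact_mod_cast h')

/-- covering number of `Γ K_{s₁,s₂}^R`. -/
theorem covering_number_Kset :
    ∃ C : ℝ, 0 < C ∧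
      ∀ (n₁ n₂ R : ℕ) (Γ s₁ s₂ ε : ℝ), 0 < Γ →
        1 ≤ s₁ → s₁ ≤ (n₁ : ℝ) → 1 ≤ s₂ → s₂ ≤ (n₂ : ℝ) → ε ∈ Set.Ioo (0 : ℝ) 1 →
        coveringNumber (Γ • Kset n₁ n₂ R s₁ s₂) (fun Z W => frobNorm (Z - W)) ε ≠ ⊤ ∧
        Real.log ((coveringNumber (Γ • Kset n₁ n₂ R s₁ s₂)
            (fun Z W => frobNorm (Z - W)) ε).toNat : ℝ) ≤
          C * ε⁻¹ ^ 2 * Γ ^ 2 * (R : ℝ) ^ 3 * (s₁ + s₂) *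
            Real.log (max (Real.exp 1 * n₁ / s₁) (Real.exp 1 * n₂ / s₂)) := by
  refine ⟨384, by norm_num, ?_⟩
  intro n₁ n₂ R Γ s₁ s₂ ε hΓ hs₁ hsn₁ hs₂ hsn₂ ⟨hε, _⟩
  have hL (n : ℕ) (s : ℝ) (hs : 1 ≤ s) (hsn : s ≤ n) : 1 ≤ Real.exp 1 * n / s := by
    rw [one_le_div (by linarith)]
    have := Real.one_le_exp zero_le_one
    nlinarith
  have hL₁ := hL n₁ s₁ hs₁ hsn₁
  have hL₂ := hL n₂ s₂ hs₂ hsn₂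
  set L := Real.log (max (Real.exp 1 * n₁ / s₁) (Real.exp 1 * n₂ / s₂)) with hLdef
  have hLL₁ : Real.log (Real.exp 1 * n₁ / s₁) ≤ L :=
    Real.log_le_log (by linarith) (le_max_left _ _)
  have hLL₂ : Real.log (Real.exp 1 * n₂ / s₂) ≤ L :=
    Real.log_le_log (by linarith) (le_max_right _ _)
  have hL0 : 0 ≤ L := (Real.log_nonneg hL₁).trans hLL₁
  have hfrob {n : ℕ} {U : Matrix (Fin n) (Fin R) ℝ} (h : frobNorm U ^ 2 ≤ R) :
      frobNorm U ≤ Real.sqrt R := Real.le_sqrt_of_sq_le h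
  have hRR : Real.sqrt R * Real.sqrt R = R := Real.mul_self_sqrt (Nat.cast_nonneg R)
  rcases lt_or_ge (Γ * R) ε with hsmall | hlarge
  · obtain ⟨h1, h2⟩ := coveringNumber_ne_top_and_log_le (K := Γ • Kset n₁ n₂ R s₁ s₂)
      (d := fun Z W => frobNorm (Z - W)) (ε := ε) {0} (by
        rintro _ ⟨_, ⟨U, V, rfl, hF, -, -⟩, rfl⟩
        refine ⟨0, by simp, ?_⟩
        have hU := hfrob ((le_max_left _ _).trans hF)
        have hV := hfrob ((le_max_right _ _).trans hF)
        simp only [sub_zero]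
        rw [frobNorm_smul, abs_of_pos hΓ]
        refine lt_of_le_of_lt ?_ hsmall
        gcongr
        refine (frobNorm_mul_transpose_le U V).trans ?_
        rw [← hRR]
        exact mul_le_mul hU hV (Real.sqrt_nonneg _) (Real.sqrt_nonneg _))
    refine ⟨h1, h2.trans ?_⟩
    simp only [Finset.card_singleton, Nat.cast_one, Real.log_one]
    positivity
  · have hR : 0 < R := by
      rcases Nat.eq_zero_or_pos R with h | h
      · subst h
        simp at hlarge
        linarith
      · exact h
    have hR' : (0 : ℝ) < R := by exact_mod_cast hR
    set η : ℝ := ε / (4 * (Γ * R)) with hη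
    have hη0 : 0 < η := by positivity
    have hη1 : η ≤ 1 / 4 := by
      rw [hη, div_le_iff₀ (by positivity)]
      linarith
    obtain ⟨T₁, hc₁, hT₁⟩ := exists_finset_log_card_le hR hs₁ hsn₁ hη0 (by linarith)
    obtain ⟨T₂, hc₂, hT₂⟩ := exists_finset_log_card_le hR hs₂ hsn₂ hη0 (by linarith)
    classical
    obtain ⟨h1, h2⟩ := coveringNumber_ne_top_and_log_le (K := Γ • Kset n₁ n₂ R s₁ s₂)
      (d := fun Z W => frobNorm (Z - W)) (ε := ε)
      ((T₁ ×ˢ T₂).image fun p => Γ • (p.1 * (p.2)ᵀ)) (by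
        rintro _ ⟨_, ⟨U, V, rfl, hF, hlU, hlV⟩, rfl⟩
        obtain ⟨U', hU'T, hU'⟩ := hT₁ U hlU
        obtain ⟨V', hV'T, hV'⟩ := hT₂ V hlV
        refine ⟨Γ • (U' * V'ᵀ), Finset.mem_image.mpr
          ⟨(U', V'), Finset.mem_product.mpr ⟨hU'T, hV'T⟩, rfl⟩, ?_⟩
        have hU := hfrob ((le_max_left _ _).trans hF)
        have hV := hfrob ((le_max_right _ _).trans hF)
        have hle : frobNorm (U * Vᵀ - U' * V'ᵀ) ≤ (2 * η + η ^ 2) * R := by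
          refine (frobNorm_mul_transpose_sub_le U U' V V').trans ?_
          calc _ ≤ η * Real.sqrt R * Real.sqrt R
                + (Real.sqrt R + η * Real.sqrt R) * (η * Real.sqrt R) := by
                  have : 0 ≤ frobNorm V := Real.sqrt_nonneg _
                  have : 0 ≤ frobNorm (V - V') := Real.sqrt_nonneg _
                  gcongr
            _ = (2 * η + η ^ 2) * (Real.sqrt R * Real.sqrt R) := by ring
            _ = _ := by rw [hRR]
        have hηε : Γ * (4 * η * R) = ε := by
          rw [hη]; field_simp
        simp only
        rw [← smul_sub, frobNorm_smul, abs_of_pos hΓ, ← hηε]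
        refine mul_lt_mul_of_pos_left (hle.trans_lt ?_) hΓ
        refine mul_lt_mul_of_pos_right ?_ hR'
        nlinarith)
    refine ⟨h1, h2.trans ?_⟩
    have hcard : Real.log (((T₁ ×ˢ T₂).image fun p => Γ • (p.1 * (p.2)ᵀ)).card : ℝ)
        ≤ Real.log T₁.card + Real.log T₂.card := by
      set c := ((T₁ ×ˢ T₂).image fun p => Γ • (p.1 * (p.2)ᵀ)).card with hc
      have hle : c ≤ T₁.card * T₂.card :=
        Finset.card_image_le.trans (Finset.card_product T₁ T₂).le
      rcases Nat.eq_zero_or_pos c with h0 | h0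
      · rw [h0]
        simpa using add_nonneg (Real.log_natCast_nonneg T₁.card) (Real.log_natCast_nonneg T₂.card)
      · have hpos : 0 < T₁.card * T₂.card := h0.trans_le hle
        have hp₁ : T₁.card ≠ 0 := fun h => by simp [h] at hpos
        have hp₂ : T₂.card ≠ 0 := fun h => by simp [h] at hpos
        rw [← Real.log_mul (by exact_mod_cast hp₁) (by exact_mod_cast hp₂)]
        exact Real.log_le_log (by exact_mod_cast h0) (by exact_mod_cast hle)
    calc _ ≤ Real.log T₁.card + Real.log T₂.card := hcard
      _ ≤ 24 * (R * s₁ / η ^ 2) * L + 24 * (R * s₂ / η ^ 2) * L := by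
          refine add_le_add (hc₁.trans ?_) (hc₂.trans ?_) <;> gcongr
      _ = _ := by
          rw [hη]
          field_simp
          ring
end
end

section
/- There is an absolute constant C > 0 with the following property. Let Γ > 0, R ∈ ℕ, 1 ≤ s₁ ≤ n₁, 1 ≤ s₂ ≤ n₂ and n₁, n₂ ≥ 2. Then the Gaussian width of Γ K_{s₁,s₂}^R satisfies w(Γ K_{s₁,s₂}^R) ≤ C · √( Γ² R³ (s₁ + s₂) · log³(max{n₁, n₂}) ). -/
open MeasureTheory ProbabilityTheory Filter Matrix Pointwise

noncomputable section

/-- The law of a standard Gaussian vector with i.i.d. `N(0,1)` entries indexed by `ι`. -/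
def stdGaussian (ι : Type*) [Fintype ι] : Measure (ι → ℝ) :=
  Measure.pi fun _ => gaussianReal 0 1

/-- The Gaussian width of a set of matrices, identified with vectors via vectorization:
`w(K) = E sup_{Z ∈ K} ⟨Z, G⟩_F` where `G` has i.i.d. standard Gaussian entries. -/
def gaussianWidth {n₁ n₂ : ℕ} (K : Set (Matrix (Fin n₁) (Fin n₂) ℝ)) : ℝ :=
  ∫ g : Fin n₁ × Fin n₂ → ℝ,
    (⨆ Z : K, ∑ i, ∑ j, (Z : Matrix (Fin n₁) (Fin n₂) ℝ) i j * g (i, j))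
      ∂(stdGaussian (Fin n₁ × Fin n₂))

/-- A function bounded by `1` splits its index set into the dyadic levels of its absolute value,
where the last level collects everything of size at most `2⁻ᴸ`. -/
lemma exists_dyadic_level {ι : Type*} (a : ι → ℝ) (ha : ∀ i, |a i| ≤ 1) (L : ℕ) :
    ∃ lev : ι → ℕ, ∀ i, lev i ≤ L ∧ |a i| ≤ (1 / 2) ^ lev i ∧
      (lev i < L → (1 / 2) ^ lev i ≤ 2 * |a i|) := by
  classical
  have hex : ∀ i, ∃ k, k = L ∨ (1 / 2 : ℝ) ^ (k + 1) < |a i| := fun i => ⟨L, Or.inl rfl⟩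
  refine ⟨fun i => Nat.find (hex i), fun i => ⟨Nat.find_min' _ (Or.inl rfl), ?_, fun hlt => ?_⟩⟩
  · change |a i| ≤ (1 / 2) ^ Nat.find (hex i)
    rcases h : Nat.find (hex i) with _ | k
    · simpa using ha i
    · have := Nat.find_min (hex i) (m := k) (by omega)
      push Not at this
      exact this.2
  · rcases Nat.find_spec (hex i) with h | h
    · exact absurd h hlt.ne
    · rw [pow_succ] at h
      linarith

/-- Cardinality estimates for the dyadic level sets of a vector with controlled `ℓ¹` and `ℓ²`
norms. -/
lemma exists_dyadic_level_card_le {ι : Type*} [Fintype ι] (a : ι → ℝ) {A : ℝ} {L : ℕ}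
    (ha2 : ∑ i, a i ^ 2 ≤ 1) (ha1 : ∑ i, |a i| ≤ A) (hA : 1 ≤ A)
    (hcard : (Fintype.card ι : ℝ) ≤ 2 ^ L) :
    ∃ lev : ι → ℕ, (∀ i, lev i ≤ L ∧ |a i| ≤ (1 / 2) ^ lev i) ∧
      ∑ k ∈ Finset.range (L + 1), (1 / 2 : ℝ) ^ k * ((Finset.univ.filter (lev · = k)).card : ℝ)
        ≤ 3 * A ∧
      ∀ k, k ≤ L →
        (1 / 2 : ℝ) ^ k * Real.sqrt ((Finset.univ.filter (lev · = k)).card : ℝ) ≤ 2 := by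
  have hle : ∀ i, |a i| ≤ 1 := fun i => by
    rw [← sq_le_one_iff_abs_le_one]
    exact (Finset.single_le_sum (f := fun i => a i ^ 2) (fun j _ => sq_nonneg _)
      (Finset.mem_univ i)).trans ha2
  obtain ⟨lev, hlev⟩ := exists_dyadic_level a hle L
  have hhalf : ∀ i, (1 / 2 : ℝ) ^ lev i ≤ 2 * |a i| + (1 / 2) ^ L := fun i => by
    rcases lt_or_eq_of_le (hlev i).1 with h | h
    · have := (hlev i).2.2 h
      have : (0 : ℝ) ≤ (1 / 2) ^ L := by positivity
      linarith
    · rw [h]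
      have := abs_nonneg (a i)
      linarith
  have hL : (1 / 2 : ℝ) ^ L * 2 ^ L = 1 := by rw [← mul_pow]; norm_num
  have hcard' : (1 / 2 : ℝ) ^ L * Fintype.card ι ≤ 1 := by
    exact (mul_le_mul_of_nonneg_left hcard (by positivity)).trans hL.le
  refine ⟨lev, fun i => ⟨(hlev i).1, (hlev i).2.1⟩, ?_, fun k hk => ?_⟩
  · have hfib : ∑ k ∈ Finset.range (L + 1),
        (1 / 2 : ℝ) ^ k * ((Finset.univ.filter (lev · = k)).card : ℝ)
        = ∑ i, (1 / 2 : ℝ) ^ lev i := by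
      rw [← Finset.sum_fiberwise_of_maps_to (s := Finset.univ) (t := Finset.range (L + 1))
        (g := lev) (fun i _ => Finset.mem_range.2 (Nat.lt_succ_of_le (hlev i).1))]
      refine Finset.sum_congr rfl fun k _ => ?_
      rw [Finset.sum_congr rfl (g := fun _ => (1 / 2 : ℝ) ^ k)
        (fun i hi => by rw [(Finset.mem_filter.1 hi).2])]
      rw [Finset.sum_const, nsmul_eq_mul, mul_comm]
    rw [hfib]
    calc ∑ i, (1 / 2 : ℝ) ^ lev i ≤ ∑ i, (2 * |a i| + (1 / 2) ^ L) :=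
          Finset.sum_le_sum fun i _ => hhalf i
      _ = 2 * ∑ i, |a i| + (1 / 2) ^ L * Fintype.card ι := by
          rw [Finset.sum_add_distrib, ← Finset.mul_sum, Finset.sum_const, nsmul_eq_mul,
            Finset.card_univ, mul_comm ((1 / 2 : ℝ) ^ L)]
      _ ≤ 3 * A := by linarith
  · set I := Finset.univ.filter (lev · = k) with hI
    have hsq : ((1 / 2 : ℝ) ^ k) ^ 2 * (I.card : ℝ) ≤ 4 := by
      rcases lt_or_eq_of_le hk with h | h
      · calc ((1 / 2 : ℝ) ^ k) ^ 2 * (I.card : ℝ) = ∑ i ∈ I, ((1 / 2 : ℝ) ^ k) ^ 2 := by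
              rw [Finset.sum_const, nsmul_eq_mul, mul_comm]
          _ ≤ ∑ i ∈ I, 4 * a i ^ 2 := by
              refine Finset.sum_le_sum fun i hi => ?_
              have hi' : lev i = k := (Finset.mem_filter.1 hi).2
              have := (hlev i).2.2 (hi' ▸ h)
              rw [hi'] at this
              calc ((1 / 2 : ℝ) ^ k) ^ 2 ≤ (2 * |a i|) ^ 2 := by gcongr
                _ = 4 * a i ^ 2 := by rw [mul_pow, sq_abs]; norm_num
          _ ≤ ∑ i, 4 * a i ^ 2 :=
              Finset.sum_le_sum_of_subset_of_nonneg (Finset.subset_univ _)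
                fun i _ _ => by positivity
          _ ≤ 4 := by rw [← Finset.mul_sum]; linarith
      · have h1 : (I.card : ℝ) ≤ Fintype.card ι := by exact_mod_cast Finset.card_le_univ I
        have h2 : (1 / 2 : ℝ) ^ k ≤ 1 := pow_le_one₀ (by norm_num) (by norm_num)
        have h3 : (1 / 2 : ℝ) ^ k * (I.card : ℝ) ≤ 1 := by
          subst h
          exact (mul_le_mul_of_nonneg_left h1 (by positivity)).trans hcard'
        have h4 : (0 : ℝ) ≤ (1 / 2) ^ k := by positivity
        nlinarith
    refine abs_le_of_sq_le_sq' (a := _) (b := (2 : ℝ)) ?_ (by norm_num) |>.2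
    rw [mul_pow, Real.sq_sqrt (by positivity)]
    linarith

/-- The number of nonzero entries of a sign vector. -/
def signCount {ι : Type*} [Fintype ι] (σ : ι → SignType) : ℝ := ∑ i, ((σ i : SignType) : ℝ) ^ 2

lemma signCount_nonneg {ι : Type*} [Fintype ι] (σ : ι → SignType) : 0 ≤ signCount σ :=
  Finset.sum_nonneg fun _ _ => sq_nonneg _

/-- A linear form on a box is at most its value at a sign vector. -/
lemma exists_sign_sum_le {ι : Type*} [Fintype ι] (I : Finset ι) (β x : ι → ℝ) {c : ℝ}
    (hx : ∀ i ∈ I, |x i| ≤ c) :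
    ∃ σ : ι → SignType, signCount σ = I.card ∧
      ∑ i ∈ I, x i * β i ≤ c * ∑ i, (σ i : ℝ) * β i := by
  classical
  refine ⟨fun i => if i ∈ I then (if 0 ≤ β i then 1 else -1) else 0, ?_, ?_⟩
  · unfold signCount
    rw [Finset.card_eq_sum_ones, Nat.cast_sum, ← Finset.sum_subset (Finset.subset_univ I)]
    · refine Finset.sum_congr rfl fun i hi => ?_
      simp only [if_pos hi]
      split_ifs <;> simp
    · intro i _ hi
      simp [hi]
  · rw [← Finset.sum_subset (Finset.subset_univ I), Finset.mul_sum]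
    · refine Finset.sum_le_sum fun i hi => ?_
      have h1 : ((if i ∈ I then (if 0 ≤ β i then (1 : SignType) else -1) else 0 : SignType) : ℝ)
          * β i = |β i| := by
        rw [if_pos hi]
        split_ifs with h
        · simp [abs_of_nonneg h]
        · simp [abs_of_neg (not_le.1 h)]
      rw [h1]
      calc x i * β i ≤ |x i * β i| := le_abs_self _
        _ = |x i| * |β i| := abs_mul _ _
        _ ≤ c * |β i| := by gcongr; exact hx i hi
    · intro i _ hi
      simp [hi]

/-- A bilinear form on a product of boxes is bounded by its values at sign vectors. -/
lemma bilin_box_le {ι κ : Type*} [Fintype ι] [Fintype κ] (I : Finset ι) (J : Finset κ)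
    (β : ι → κ → ℝ) (a : ι → ℝ) (b : κ → ℝ) {c d W : ℝ} (hc : 0 ≤ c) (hd : 0 ≤ d)
    (ha : ∀ i ∈ I, |a i| ≤ c) (hb : ∀ j ∈ J, |b j| ≤ d)
    (hW : ∀ (σ : ι → SignType) (τ : κ → SignType), signCount σ = I.card → signCount τ = J.card →
      ∑ i, ∑ j, (σ i : ℝ) * (τ j : ℝ) * β i j ≤ W) :
    ∑ i ∈ I, ∑ j ∈ J, a i * b j * β i j ≤ c * d * W := by
  obtain ⟨σ, hσ, h1⟩ := exists_sign_sum_le I (fun i => ∑ j ∈ J, b j * β i j) a ha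
  obtain ⟨τ, hτ, h2⟩ := exists_sign_sum_le J (fun j => ∑ i, (σ i : ℝ) * β i j) b hb
  calc ∑ i ∈ I, ∑ j ∈ J, a i * b j * β i j = ∑ i ∈ I, a i * ∑ j ∈ J, b j * β i j := by
        simp only [Finset.mul_sum, mul_assoc]
    _ ≤ c * ∑ i, (σ i : ℝ) * ∑ j ∈ J, b j * β i j := h1
    _ = c * ∑ j ∈ J, b j * ∑ i, (σ i : ℝ) * β i j := by
        congr 1
        simp only [Finset.mul_sum]
        rw [Finset.sum_comm]
        exact Finset.sum_congr rfl fun j _ => Finset.sum_congr rfl fun i _ => by ring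
    _ ≤ c * (d * ∑ j, (τ j : ℝ) * ∑ i, (σ i : ℝ) * β i j) := by gcongr
    _ = c * d * ∑ i, ∑ j, (σ i : ℝ) * (τ j : ℝ) * β i j := by
        rw [mul_assoc]
        congr 2
        simp only [Finset.mul_sum]
        rw [Finset.sum_comm]
        exact Finset.sum_congr rfl fun j _ => Finset.sum_congr rfl fun i _ => by ring
    _ ≤ c * d * W := by gcongr; exact hW σ τ hσ hτ

/-- A bilinear form controlled on sign vectors is controlled on vectors with bounded `ℓ¹` and `ℓ²`
norms. -/
lemma bilin_le_of_sign_le {ι κ : Type*} [Fintype ι] [Fintype κ] (β : ι → κ → ℝ)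
    (a : ι → ℝ) (b : κ → ℝ) {A B M : ℝ} {L : ℕ} (hM : 0 ≤ M)
    (ha2 : ∑ i, a i ^ 2 ≤ 1) (ha1 : ∑ i, |a i| ≤ A) (hA : 1 ≤ A)
    (hb2 : ∑ j, b j ^ 2 ≤ 1) (hb1 : ∑ j, |b j| ≤ B) (hB : 1 ≤ B)
    (hι : (Fintype.card ι : ℝ) ≤ 2 ^ L) (hκ : (Fintype.card κ : ℝ) ≤ 2 ^ L)
    (hW : ∀ (σ : ι → SignType) (τ : κ → SignType),
      ∑ i, ∑ j, (σ i : ℝ) * (τ j : ℝ) * β i j ≤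
        √(signCount σ) * √(signCount τ) * √(signCount σ + signCount τ) * M) :
    ∑ i, ∑ j, a i * b j * β i j ≤ 6 * (L + 1) * (A + B) * M := by
  obtain ⟨u, hu, hu1, hu2⟩ := exists_dyadic_level_card_le a ha2 ha1 hA hι
  obtain ⟨v, hv, hv1, hv2⟩ := exists_dyadic_level_card_le b hb2 hb1 hB hκ
  set p : ℕ → ℝ := fun k => ((Finset.univ.filter (u · = k)).card : ℝ) with hp
  set q : ℕ → ℝ := fun k => ((Finset.univ.filter (v · = k)).card : ℝ) with hq
  have hp0 : ∀ k, 0 ≤ p k := fun k => Nat.cast_nonneg _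
  have hq0 : ∀ k, 0 ≤ q k := fun k => Nat.cast_nonneg _
  have hbox : ∀ k l, ∑ i with u i = k, ∑ j with v j = l, a i * b j * β i j ≤
      (1 / 2) ^ k * (1 / 2) ^ l * (√(p k) * √(q l) * √(p k + q l) * M) := by
    intro k l
    refine bilin_box_le _ _ β a b (by positivity) (by positivity) ?_ ?_ ?_
    · intro i hi
      rw [← (Finset.mem_filter.1 hi).2]
      exact (hu i).2
    · intro j hj
      rw [← (Finset.mem_filter.1 hj).2]
      exact (hv j).2
    · intro σ τ hσ hτ
      have := hW σ τ
      rwa [hσ, hτ] at this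
  have hterm : ∀ k ∈ Finset.range (L + 1), ∀ l ∈ Finset.range (L + 1),
      (1 / 2 : ℝ) ^ k * (1 / 2) ^ l * (√(p k) * √(q l) * √(p k + q l) * M) ≤
        2 * M * ((1 / 2) ^ k * p k) + 2 * M * ((1 / 2) ^ l * q l) := by
    intro k hk l hl
    have h1 := hu2 k (Nat.lt_succ_iff.1 (Finset.mem_range.1 hk))
    have h2 := hv2 l (Nat.lt_succ_iff.1 (Finset.mem_range.1 hl))
    change (1 / 2 : ℝ) ^ k * √(p k) ≤ 2 at h1
    change (1 / 2 : ℝ) ^ l * √(q l) ≤ 2 at h2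
    have hs : √(p k + q l) ≤ √(p k) + √(q l) := by
      rw [Real.sqrt_le_left (by positivity), add_sq, Real.sq_sqrt (hp0 k), Real.sq_sqrt (hq0 l)]
      have : 0 ≤ 2 * √(p k) * √(q l) := by positivity
      linarith
    have e1 := Real.mul_self_sqrt (hp0 k)
    have e2 := Real.mul_self_sqrt (hq0 l)
    calc (1 / 2 : ℝ) ^ k * (1 / 2) ^ l * (√(p k) * √(q l) * √(p k + q l) * M)
        ≤ (1 / 2 : ℝ) ^ k * (1 / 2) ^ l * (√(p k) * √(q l) * (√(p k) + √(q l)) * M) := by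
          gcongr
      _ = ((1 / 2 : ℝ) ^ l * √(q l)) * (M * ((1 / 2) ^ k * (√(p k) * √(p k)))) +
          ((1 / 2 : ℝ) ^ k * √(p k)) * (M * ((1 / 2) ^ l * (√(q l) * √(q l)))) := by ring
      _ ≤ 2 * (M * ((1 / 2) ^ k * (√(p k) * √(p k)))) +
          2 * (M * ((1 / 2) ^ l * (√(q l) * √(q l)))) := by gcongr
      _ = _ := by rw [e1, e2]; ring
  calc ∑ i, ∑ j, a i * b j * β i j
      = ∑ k ∈ Finset.range (L + 1), ∑ l ∈ Finset.range (L + 1),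
          ∑ i with u i = k, ∑ j with v j = l, a i * b j * β i j := by
        rw [← Finset.sum_fiberwise_of_maps_to (s := Finset.univ) (t := Finset.range (L + 1))
          (g := u) (fun i _ => Finset.mem_range.2 (Nat.lt_succ_of_le (hu i).1))]
        refine Finset.sum_congr rfl fun k _ => ?_
        rw [Finset.sum_comm (s := Finset.range (L + 1))]
        refine Finset.sum_congr rfl fun i _ => ?_
        rw [Finset.sum_fiberwise_of_maps_to (s := Finset.univ) (t := Finset.range (L + 1))
          (g := v) (fun j _ => Finset.mem_range.2 (Nat.lt_succ_of_le (hv j).1))]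
    _ ≤ ∑ k ∈ Finset.range (L + 1), ∑ l ∈ Finset.range (L + 1),
          (2 * M * ((1 / 2) ^ k * p k) + 2 * M * ((1 / 2) ^ l * q l)) :=
        Finset.sum_le_sum fun k hk => Finset.sum_le_sum fun l hl =>
          (hbox k l).trans (hterm k hk l hl)
    _ = 2 * M * (L + 1) * (∑ k ∈ Finset.range (L + 1), (1 / 2) ^ k * p k) +
          2 * M * (L + 1) * (∑ l ∈ Finset.range (L + 1), (1 / 2) ^ l * q l) := by
        simp only [Finset.sum_add_distrib, Finset.sum_const, Finset.card_range, nsmul_eq_mul,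
          ← Finset.mul_sum]
        push_cast
        ring
    _ ≤ 2 * M * (L + 1) * (3 * A) + 2 * M * (L + 1) * (3 * B) := by gcongr
    _ = 6 * (L + 1) * (A + B) * M := by ring

lemma integrable_exp_stdGaussian {ι : Type*} [Fintype ι] (c : ι → ℝ) :
    Integrable (fun g => Real.exp (∑ i, c i * g i)) (_root_.stdGaussian ι) := by
  simp only [Real.exp_sum]
  exact Integrable.fintype_prod_dep (f := fun i x => Real.exp (c i * x))
    fun i => integrable_exp_mul_gaussianReal (c i)

lemma integral_exp_stdGaussian {ι : Type*} [Fintype ι] (c : ι → ℝ) :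
    ∫ g, Real.exp (∑ i, c i * g i) ∂(_root_.stdGaussian ι) = Real.exp ((∑ i, c i ^ 2) / 2) := by
  simp only [Real.exp_sum, Finset.sum_div]
  refine (integral_fintype_prod_eq_prod (μ := fun _ : ι => gaussianReal 0 1)
    (fun i x => Real.exp (c i * x))).trans (Finset.prod_congr rfl fun i _ => ?_)
  have := congrFun (mgf_fun_id_gaussianReal (μ := 0) (v := 1)) (c i)
  simpa [mgf] using this

/-- An exponentially weighted count of sign vectors. -/
lemma sum_exp_neg_signCount_le {ι : Type*} [Fintype ι] [DecidableEq ι] {ℓ : ℝ}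
    (hι : (Fintype.card ι : ℝ) ≤ Real.exp ℓ) :
    ∑ σ : ι → SignType, Real.exp (-ℓ * signCount σ) ≤ Real.exp 2 := by
  have h1 : ∑ σ : ι → SignType, Real.exp (-ℓ * signCount σ) =
      (1 + 2 * Real.exp (-ℓ)) ^ Fintype.card ι := by
    simp only [signCount, Finset.mul_sum, Real.exp_sum]
    rw [← Fintype.prod_sum (fun (_ : ι) (s : SignType) => Real.exp (-ℓ * (s : ℝ) ^ 2))]
    rw [Finset.prod_const, Finset.card_univ]
    congr 1
    rw [SignType.univ_eq]
    simp
    ring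
  rw [h1]
  calc (1 + 2 * Real.exp (-ℓ)) ^ Fintype.card ι
      ≤ Real.exp (2 * Real.exp (-ℓ)) ^ Fintype.card ι := by
        gcongr
        rw [add_comm]
        exact Real.add_one_le_exp _
    _ = Real.exp (2 * (Fintype.card ι * Real.exp (-ℓ))) := by
        rw [← Real.exp_nat_mul]; ring_nf
    _ ≤ Real.exp 2 := by
        gcongr
        have : (Fintype.card ι : ℝ) * Real.exp (-ℓ) ≤ Real.exp ℓ * Real.exp (-ℓ) := by gcongr
        rw [← Real.exp_add, add_neg_cancel, Real.exp_zero] at this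
        linarith

lemma sum_block_form {n₁ n₂ R : ℕ} (a : Fin n₁ × Fin R → ℝ) (b : Fin n₂ × Fin R → ℝ)
    (g : Fin n₁ × Fin n₂ → ℝ) :
    ∑ x, ∑ y, a x * b y * (if x.2 = y.2 then g (x.1, y.1) else 0) =
      ∑ z : Fin n₁ × Fin n₂, (∑ r, a (z.1, r) * b (z.2, r)) * g z := by
  simp only [Fintype.sum_prod_type, mul_ite, mul_zero, Finset.sum_ite_eq, Finset.mem_univ, if_true,
    Finset.sum_mul]
  refine Finset.sum_congr rfl fun i _ => ?_
  rw [Finset.sum_comm]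

lemma sum_sq_block_le {n₁ n₂ R : ℕ} (a : Fin n₁ × Fin R → ℝ) (b : Fin n₂ × Fin R → ℝ) :
    ∑ z : Fin n₁ × Fin n₂, (∑ r, a (z.1, r) * b (z.2, r)) ^ 2 ≤ (∑ x, a x ^ 2) * ∑ y, b y ^ 2 := by
  simp only [Fintype.sum_prod_type]
  rw [Finset.sum_mul_sum]
  exact Finset.sum_le_sum fun i _ => Finset.sum_le_sum fun j _ =>
    Finset.sum_mul_sq_le_sq_mul_sq _ _ _

lemma block_form_eq_zero_of_sum_sq_eq_zero {n₁ n₂ R : ℕ} {a : Fin n₁ × Fin R → ℝ}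
    {b : Fin n₂ × Fin R → ℝ} (g : Fin n₁ × Fin n₂ → ℝ)
    (h : (∑ x, a x ^ 2) * ∑ y, b y ^ 2 = 0) :
    ∑ z : Fin n₁ × Fin n₂, (∑ r, a (z.1, r) * b (z.2, r)) * g z = 0 := by
  have h0 : ∑ z : Fin n₁ × Fin n₂, (∑ r, a (z.1, r) * b (z.2, r)) ^ 2 = 0 :=
    le_antisymm ((sum_sq_block_le a b).trans h.le) (Finset.sum_nonneg fun _ _ => sq_nonneg _)
  rw [Finset.sum_eq_zero_iff_of_nonneg fun _ _ => sq_nonneg _] at h0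
  exact Finset.sum_eq_zero fun z hz => by rw [pow_eq_zero_iff two_ne_zero |>.1 (h0 z hz), zero_mul]

lemma one_le_signCount {ι : Type*} [Fintype ι] {σ : ι → SignType} (h : signCount σ ≠ 0) :
    1 ≤ signCount σ := by
  obtain ⟨i, -, hi⟩ := Finset.exists_ne_zero_of_sum_ne_zero h
  refine le_trans ?_ (Finset.single_le_sum (f := fun i => ((σ i : SignType) : ℝ) ^ 2)
    (fun j _ => sq_nonneg _) (Finset.mem_univ i))
  rcases h' : σ i <;> simp_all

/-- A Gaussian bilinear form is simultaneously controlled on all sign vectors by a random variable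
of bounded expectation. -/
lemma exists_sign_form_bound {n₁ n₂ R : ℕ} {ℓ : ℝ} (hℓ : 1 ≤ ℓ)
    (h₁ : (Fintype.card (Fin n₁ × Fin R) : ℝ) ≤ Real.exp ℓ)
    (h₂ : (Fintype.card (Fin n₂ × Fin R) : ℝ) ≤ Real.exp ℓ) :
    ∃ S : (Fin n₁ × Fin n₂ → ℝ) → ℝ, (∀ g, 0 ≤ S g) ∧
      Integrable S (_root_.stdGaussian (Fin n₁ × Fin n₂)) ∧
      ∫ g, S g ∂(_root_.stdGaussian (Fin n₁ × Fin n₂)) ≤ Real.exp 4 ∧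
      ∀ g (σ : Fin n₁ × Fin R → SignType) (τ : Fin n₂ × Fin R → SignType),
        ∑ x, ∑ y, (σ x : ℝ) * (τ y : ℝ) * (if x.2 = y.2 then g (x.1, y.1) else 0) ≤
          √(signCount σ) * √(signCount τ) * √(signCount σ + signCount τ) *
            (√ℓ * (3 / 2 + S g)) := by
  set μ := _root_.stdGaussian (Fin n₁ × Fin n₂) with hμ
  let w : (Fin n₁ × Fin R → SignType) → (Fin n₂ × Fin R → SignType) → ℝ := fun σ τ =>
    √(ℓ * (signCount σ + signCount τ)) / (√(signCount σ) * √(signCount τ))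
  let c : (Fin n₁ × Fin R → SignType) → (Fin n₂ × Fin R → SignType) → Fin n₁ × Fin n₂ → ℝ :=
    fun σ τ z => w σ τ * ∑ r, (σ (z.1, r) : ℝ) * (τ (z.2, r) : ℝ)
  let T : (Fin n₁ × Fin R → SignType) → (Fin n₂ × Fin R → SignType) →
      (Fin n₁ × Fin n₂ → ℝ) → ℝ := fun σ τ g =>
    Real.exp (-(3 / 2 * ℓ * (signCount σ + signCount τ))) * Real.exp (∑ z, c σ τ z * g z)
  have hT0 : ∀ σ τ g, 0 ≤ T σ τ g := fun σ τ g => by positivity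
  have hTint : ∀ σ τ, Integrable (T σ τ) μ := fun σ τ =>
    (integrable_exp_stdGaussian (c σ τ)).const_mul _
  have hc : ∀ σ τ, ∑ z, c σ τ z ^ 2 ≤ ℓ * (signCount σ + signCount τ) := by
    intro σ τ
    have hσ := signCount_nonneg σ
    have hτ := signCount_nonneg τ
    simp only [c, mul_pow, ← Finset.mul_sum]
    have hblock := sum_sq_block_le (fun x => (σ x : ℝ)) (fun y => (τ y : ℝ))
    calc w σ τ ^ 2 * ∑ z : Fin n₁ × Fin n₂, (∑ r, (σ (z.1, r) : ℝ) * (τ (z.2, r) : ℝ)) ^ 2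
        ≤ w σ τ ^ 2 * (signCount σ * signCount τ) := by gcongr; exact hblock
      _ = ℓ * (signCount σ + signCount τ) *
            ((signCount σ * signCount τ) / (signCount σ * signCount τ)) := by
          simp only [w, div_pow, mul_pow]
          rw [Real.sq_sqrt (by positivity), Real.sq_sqrt hσ, Real.sq_sqrt hτ]
          ring
      _ ≤ ℓ * (signCount σ + signCount τ) * 1 := by
          gcongr
          exact div_self_le_one _
      _ = _ := mul_one _
  have hTE : ∀ σ τ, ∫ g, T σ τ g ∂μ ≤
      Real.exp (-ℓ * signCount σ) * Real.exp (-ℓ * signCount τ) := by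
    intro σ τ
    simp only [T]
    rw [integral_const_mul, integral_exp_stdGaussian, ← Real.exp_add, ← Real.exp_add,
      Real.exp_le_exp]
    have := hc σ τ
    linarith
  refine ⟨fun g => ∑ σ, ∑ τ, T σ τ g, fun g => Finset.sum_nonneg fun σ _ =>
    Finset.sum_nonneg fun τ _ => hT0 σ τ g, ?_, ?_, ?_⟩
  · exact integrable_finsetSum _ fun σ _ => integrable_finsetSum _ fun τ _ => hTint σ τ
  · rw [integral_finsetSum _ fun σ _ => integrable_finsetSum _ fun τ _ => hTint σ τ]
    calc ∑ σ, ∫ g, ∑ τ, T σ τ g ∂μ = ∑ σ, ∑ τ, ∫ g, T σ τ g ∂μ :=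
          Finset.sum_congr rfl fun σ _ => integral_finsetSum _ fun τ _ => hTint σ τ
      _ ≤ ∑ σ : Fin n₁ × Fin R → SignType, ∑ τ : Fin n₂ × Fin R → SignType,
            Real.exp (-ℓ * signCount σ) * Real.exp (-ℓ * signCount τ) :=
          Finset.sum_le_sum fun σ _ => Finset.sum_le_sum fun τ _ => hTE σ τ
      _ = (∑ σ : Fin n₁ × Fin R → SignType, Real.exp (-ℓ * signCount σ)) *
            ∑ τ : Fin n₂ × Fin R → SignType, Real.exp (-ℓ * signCount τ) := by
          rw [Finset.sum_mul_sum]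
      _ ≤ Real.exp 2 * Real.exp 2 := by
          gcongr
          · exact sum_exp_neg_signCount_le h₁
          · exact sum_exp_neg_signCount_le h₂
      _ = Real.exp 4 := by rw [← Real.exp_add]; norm_num
  · intro g σ τ
    rw [sum_block_form (fun x => (σ x : ℝ)) (fun y => (τ y : ℝ)) g]
    set S := ∑ σ, ∑ τ, T σ τ g with hS
    have hS0 : 0 ≤ S := Finset.sum_nonneg fun σ _ => Finset.sum_nonneg fun τ _ => hT0 σ τ g
    have hσ := signCount_nonneg σ
    have hτ := signCount_nonneg τ
    by_cases h0 : signCount σ * signCount τ = 0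
    · rw [block_form_eq_zero_of_sum_sq_eq_zero g h0]
      positivity
    · have hp1 := one_le_signCount (left_ne_zero_of_mul h0)
      have hq1 := one_le_signCount (right_ne_zero_of_mul h0)
      set p := signCount σ
      set q := signCount τ
      set X := ∑ z : Fin n₁ × Fin n₂, (∑ r, (σ (z.1, r) : ℝ) * (τ (z.2, r) : ℝ)) * g z with hX
      have hcX : ∑ z, c σ τ z * g z = w σ τ * X := by
        rw [hX, Finset.mul_sum]
        exact Finset.sum_congr rfl fun z _ => mul_assoc _ _ _
      have hTS : T σ τ g ≤ S :=
        (Finset.single_le_sum (f := fun τ => T σ τ g) (fun τ _ => hT0 σ τ g)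
          (Finset.mem_univ τ)).trans
        (Finset.single_le_sum (f := fun σ => ∑ τ, T σ τ g)
          (fun σ _ => Finset.sum_nonneg fun τ _ => hT0 σ τ g) (Finset.mem_univ σ))
      have hexp : w σ τ * X - 3 / 2 * ℓ * (p + q) ≤ S := by
        refine le_trans ?_ hTS
        simp only [T]
        rw [hcX, ← Real.exp_add]
        have := Real.add_one_le_exp (-(3 / 2 * ℓ * (p + q)) + w σ τ * X)
        linarith
      set P := √p * √q with hP
      have hP0 : 0 < P := by positivity
      set Q := √(ℓ * (p + q)) with hQ
      have hQ1 : 1 ≤ Q := by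
        rw [hQ, Real.one_le_sqrt]
        nlinarith
      have hQ2 : Q * Q = ℓ * (p + q) := Real.mul_self_sqrt (by positivity)
      have hw : w σ τ * P = Q := div_mul_cancel₀ _ hP0.ne'
      have hQsplit : Q = √ℓ * √(p + q) := Real.sqrt_mul (by positivity) _
      have hmain : Q * X ≤ Q * (P * Q * (3 / 2 + S)) := by
        calc Q * X = P * (w σ τ * X) := by rw [← hw]; ring
          _ ≤ P * (3 / 2 * (Q * Q) + S) := by
              gcongr
              rw [hQ2]
              linarith
          _ ≤ P * (3 / 2 * (Q * Q) + Q * Q * S) := by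
              gcongr
              exact le_mul_of_one_le_left hS0 (one_le_mul_of_one_le_of_one_le hQ1 hQ1)
          _ = Q * (P * Q * (3 / 2 + S)) := by ring
      have := le_of_mul_le_mul_left hmain (by linarith)
      calc X ≤ P * Q * (3 / 2 + S) := this
        _ = P * √(p + q) * (√ℓ * (3 / 2 + S)) := by rw [hQsplit]; ring

lemma zero_mem_smul_Kset (n₁ n₂ R : ℕ) (Γ s₁ s₂ : ℝ) : 0 ∈ Γ • Kset n₁ n₂ R s₁ s₂ := by
  refine ⟨0, ⟨0, 0, by simp, ?_, ?_, ?_⟩, by simp⟩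
  · simp [frobNorm]
  · simp only [l1Norm, Matrix.zero_apply, abs_zero, Finset.sum_const_zero]
    positivity
  · simp only [l1Norm, Matrix.zero_apply, abs_zero, Finset.sum_const_zero]
    positivity

lemma frobNorm_sq_s5 {n R : ℕ} (U : Matrix (Fin n) (Fin R) ℝ) :
    frobNorm U ^ 2 = ∑ x : Fin n × Fin R, U x.1 x.2 ^ 2 := by
  rw [frobNorm, Real.sq_sqrt (by positivity), Fintype.sum_prod_type]

lemma l1Norm_eq_sum_prod {n R : ℕ} (U : Matrix (Fin n) (Fin R) ℝ) :
    l1Norm U = ∑ x : Fin n × Fin R, |U x.1 x.2| := by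
  rw [l1Norm, Fintype.sum_prod_type]

lemma frob_smul_mul_transpose {n₁ n₂ R : ℕ} (Γ : ℝ) (U : Matrix (Fin n₁) (Fin R) ℝ)
    (V : Matrix (Fin n₂) (Fin R) ℝ) (g : Fin n₁ × Fin n₂ → ℝ) :
    ∑ i, ∑ j, (Γ • (U * Vᵀ)) i j * g (i, j) =
      Γ * ∑ z : Fin n₁ × Fin n₂, (∑ r, U z.1 r * V z.2 r) * g z := by
  simp only [Fintype.sum_prod_type, Finset.mul_sum, Matrix.smul_apply, Matrix.mul_apply,
    Matrix.transpose_apply, smul_eq_mul]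
  refine Finset.sum_congr rfl fun i _ => Finset.sum_congr rfl fun j _ => ?_
  rw [← Finset.mul_sum, mul_assoc]

/-- A pointwise integrable bound of expectation `b` on the linear forms over `K` bounds the
Gaussian width of `K`. -/
lemma gaussianWidth_le_of_forall_le {n₁ n₂ : ℕ} {K : Set (Matrix (Fin n₁) (Fin n₂) ℝ)}
    (h0 : 0 ∈ K) {f : (Fin n₁ × Fin n₂ → ℝ) → ℝ}
    (hf : Integrable f (_root_.stdGaussian (Fin n₁ × Fin n₂)))
    (hK : ∀ g, ∀ Z ∈ K, ∑ i, ∑ j, Z i j * g (i, j) ≤ f g) :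
    gaussianWidth K ≤ ∫ g, f g ∂(_root_.stdGaussian (Fin n₁ × Fin n₂)) := by
  have : Nonempty K := ⟨⟨0, h0⟩⟩
  refine integral_mono_of_nonneg (ae_of_all _ fun g => ?_) hf (ae_of_all _ fun g => ?_)
  · have hbdd : BddAbove (Set.range fun Z : K =>
        ∑ i, ∑ j, (Z : Matrix (Fin n₁) (Fin n₂) ℝ) i j * g (i, j)) := by
      refine ⟨f g, ?_⟩
      rintro _ ⟨Z, rfl⟩
      exact hK g Z Z.2
    refine le_trans ?_ (le_ciSup hbdd ⟨0, h0⟩)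
    simp
  · exact ciSup_le fun Z => hK g Z Z.2

lemma integrable_sq_stdGaussian {ι : Type*} [Fintype ι] (i : ι) :
    Integrable (fun g : ι → ℝ => g i ^ 2) (_root_.stdGaussian ι) := by
  have h : Integrable (fun x : ℝ => x ^ 2) (gaussianReal 0 1) :=
    (memLp_id_gaussianReal 2).integrable_sq
  exact ((measurePreserving_eval (fun _ : ι => gaussianReal 0 1) i).integrable_comp
    h.aestronglyMeasurable).2 h

lemma integral_sq_stdGaussian {ι : Type*} [Fintype ι] (i : ι) :
    ∫ g : ι → ℝ, g i ^ 2 ∂(_root_.stdGaussian ι) = 1 := by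
  have hmp := measurePreserving_eval (fun _ : ι => gaussianReal 0 1) i
  have h1 : ∫ g : ι → ℝ, g i ^ 2 ∂(_root_.stdGaussian ι) = ∫ x, x ^ 2 ∂(gaussianReal 0 1) := by
    rw [← hmp.map_eq, integral_map hmp.measurable.aemeasurable (by fun_prop)]
    rfl
  rw [h1]
  have h2 := variance_id_gaussianReal (μ := 0) (v := 1)
  rw [variance_eq_integral measurable_id.aemeasurable] at h2
  simpa using h2

/-- The dimension-dependent bound coming from the Frobenius norm. -/
lemma gaussianWidth_smul_Kset_le_mul_max {n₁ n₂ R N : ℕ} {Γ s₁ s₂ : ℝ} (hΓ : 0 < Γ) (hN : 0 < N)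
    (h₁ : n₁ ≤ N) (h₂ : n₂ ≤ N) :
    gaussianWidth (Γ • Kset n₁ n₂ R s₁ s₂) ≤ Γ * (R * N) := by
  set μ := _root_.stdGaussian (Fin n₁ × Fin n₂) with hμ
  have : IsProbabilityMeasure μ := by
    rw [hμ, _root_.stdGaussian]; infer_instance
  have hN' : (0 : ℝ) < N := by exact_mod_cast hN
  have hsq : Integrable (fun g : Fin n₁ × Fin n₂ → ℝ => ∑ z, g z ^ 2) μ :=
    integrable_finsetSum _ fun z _ => integrable_sq_stdGaussian z
  have hint : Integrable (fun g : Fin n₁ × Fin n₂ → ℝ =>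
      Γ * (R * (((∑ z, g z ^ 2) / N + N) / 2))) μ :=
    ((((hsq.div_const _).add (integrable_const _)).div_const _).const_mul _).const_mul _
  refine (gaussianWidth_le_of_forall_le (zero_mem_smul_Kset _ _ _ _ _ _) hint ?_).trans ?_
  · rintro g _ ⟨_, ⟨U, V, rfl, hF, -, -⟩, rfl⟩
    change ∑ i, ∑ j, (Γ • (U * Vᵀ)) i j * g (i, j) ≤ _
    rw [frob_smul_mul_transpose]
    gcongr
    have hU := (le_max_left _ _).trans hF
    have hV := (le_max_right _ _).trans hF
    rw [frobNorm_sq_s5] at hU hV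
    have hG : 0 ≤ ∑ z, g z ^ 2 := by positivity
    refine (abs_le_of_sq_le_sq' ?_ (by positivity)).2
    calc (∑ z : Fin n₁ × Fin n₂, (∑ r, U z.1 r * V z.2 r) * g z) ^ 2
        ≤ (∑ z : Fin n₁ × Fin n₂, (∑ r, U z.1 r * V z.2 r) ^ 2) * ∑ z, g z ^ 2 :=
          Finset.sum_mul_sq_le_sq_mul_sq _ _ _
      _ ≤ ((∑ x : Fin n₁ × Fin R, U x.1 x.2 ^ 2) * ∑ y : Fin n₂ × Fin R, V y.1 y.2 ^ 2) *
            ∑ z, g z ^ 2 := by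
          gcongr
          exact sum_sq_block_le (fun x => U x.1 x.2) (fun y => V y.1 y.2)
      _ ≤ (R * R) * ∑ z, g z ^ 2 := by gcongr
      _ ≤ (R * R) * (((∑ z, g z ^ 2) / N + N) / 2) ^ 2 := by
          gcongr
          set G := ∑ z, g z ^ 2
          have hG' : G / N * N = G := div_mul_cancel₀ _ hN'.ne'
          nlinarith [sq_nonneg (G / N - N)]
      _ = _ := by ring
  · rw [integral_const_mul, integral_const_mul, integral_div, integral_add (hsq.div_const _)
      (integrable_const _), integral_div, integral_finsetSum _
      fun z _ => integrable_sq_stdGaussian z]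
    simp only [integral_sq_stdGaussian, Finset.sum_const, Finset.card_univ, Fintype.card_prod,
      Fintype.card_fin, nsmul_eq_mul, mul_one, integral_const, probReal_univ, smul_eq_mul, one_mul]
    gcongr
    have : ((n₁ * n₂ : ℕ) : ℝ) / N ≤ N := by
      rw [div_le_iff₀ hN']
      exact_mod_cast Nat.mul_le_mul h₁ h₂
    linarith

/-- The linear form attached to `g`, on factors normalised to the unit ball. -/
lemma frob_smul_Kset_le {n₁ n₂ R L : ℕ} {Γ s₁ s₂ M : ℝ} (hΓ : 0 < Γ) (hR : 1 ≤ R) (hs₁ : 1 ≤ s₁)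
    (hs₂ : 1 ≤ s₂) (hM : 0 ≤ M)
    (h₁ : (Fintype.card (Fin n₁ × Fin R) : ℝ) ≤ 2 ^ L)
    (h₂ : (Fintype.card (Fin n₂ × Fin R) : ℝ) ≤ 2 ^ L) (g : Fin n₁ × Fin n₂ → ℝ)
    (hW : ∀ (σ : Fin n₁ × Fin R → SignType) (τ : Fin n₂ × Fin R → SignType),
      ∑ x, ∑ y, (σ x : ℝ) * (τ y : ℝ) * (if x.2 = y.2 then g (x.1, y.1) else 0) ≤
        √(signCount σ) * √(signCount τ) * √(signCount σ + signCount τ) * M)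
    {Z : Matrix (Fin n₁) (Fin n₂) ℝ} (hZ : Z ∈ Γ • Kset n₁ n₂ R s₁ s₂) :
    ∑ i, ∑ j, Z i j * g (i, j) ≤
      Γ * (R * (6 * (L + 1) * (√R * √s₁ + √R * √s₂) * M)) := by
  obtain ⟨_, ⟨U, V, rfl, hF, hU1, hV1⟩, rfl⟩ := hZ
  change ∑ i, ∑ j, (Γ • (U * Vᵀ)) i j * g (i, j) ≤ _
  have hR' : (1 : ℝ) ≤ R := by exact_mod_cast hR
  have hU2 := (le_max_left _ _).trans hF
  have hV2 := (le_max_right _ _).trans hF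
  rw [frobNorm_sq_s5] at hU2 hV2
  rw [l1Norm_eq_sum_prod] at hU1 hV1
  have hsR : 1 ≤ √(R : ℝ) := Real.one_le_sqrt.2 hR'
  have hsR0 : 0 < √(R : ℝ) := by linarith
  have hRR : √(R : ℝ) * √R = R := Real.mul_self_sqrt (by linarith)
  have hl2 : ∀ {n : ℕ} {W : Matrix (Fin n) (Fin R) ℝ}, ∑ x : Fin n × Fin R, W x.1 x.2 ^ 2 ≤ R →
      ∑ x : Fin n × Fin R, (W x.1 x.2 / √R) ^ 2 ≤ 1 := by
    intro n W h
    simp only [div_pow, ← Finset.sum_div]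
    rw [div_le_one (by positivity), Real.sq_sqrt (by positivity)]
    exact h
  have hl1 : ∀ {n : ℕ} {W : Matrix (Fin n) (Fin R) ℝ} {s : ℝ},
      ∑ x : Fin n × Fin R, |W x.1 x.2| ≤ R * √s →
      ∑ x : Fin n × Fin R, |W x.1 x.2 / √R| ≤ √R * √s := by
    intro n W s h
    simp only [abs_div, abs_of_pos hsR0, ← Finset.sum_div]
    rw [div_le_iff₀ hsR0]
    calc _ ≤ _ := h
      _ = _ := by rw [mul_right_comm, hRR]
  have hone : ∀ {s : ℝ}, 1 ≤ s → 1 ≤ √(R : ℝ) * √s := fun h =>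
    one_le_mul_of_one_le_of_one_le hsR (Real.one_le_sqrt.2 h)
  have key := bilin_le_of_sign_le (fun x y => if x.2 = y.2 then g (x.1, y.1) else 0)
    (fun x : Fin n₁ × Fin R => U x.1 x.2 / √R) (fun y : Fin n₂ × Fin R => V y.1 y.2 / √R)
    hM (hl2 hU2) (hl1 hU1) (hone hs₁) (hl2 hV2) (hl1 hV1) (hone hs₂) h₁ h₂ hW
  rw [sum_block_form] at key
  rw [frob_smul_mul_transpose]
  gcongr
  calc ∑ z : Fin n₁ × Fin n₂, (∑ r, U z.1 r * V z.2 r) * g z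
      = R * ∑ z : Fin n₁ × Fin n₂, (∑ r, U z.1 r / √R * (V z.2 r / √R)) * g z := by
        rw [Finset.mul_sum]
        refine Finset.sum_congr rfl fun z _ => ?_
        rw [← mul_assoc, Finset.mul_sum]
        congr 1
        refine Finset.sum_congr rfl fun r _ => ?_
        rw [div_mul_div_comm, hRR]
        field_simp
    _ ≤ _ := by gcongr

/-- The bound through sign vectors, before optimising the parameters. -/
lemma gaussianWidth_smul_Kset_le_of_card_le {n₁ n₂ R L : ℕ} {Γ s₁ s₂ ℓ : ℝ} (hΓ : 0 < Γ)
    (hR : 1 ≤ R) (hs₁ : 1 ≤ s₁) (hs₂ : 1 ≤ s₂) (hℓ : 1 ≤ ℓ)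
    (h₁ : (Fintype.card (Fin n₁ × Fin R) : ℝ) ≤ 2 ^ L)
    (h₂ : (Fintype.card (Fin n₂ × Fin R) : ℝ) ≤ 2 ^ L)
    (h₁' : (Fintype.card (Fin n₁ × Fin R) : ℝ) ≤ Real.exp ℓ)
    (h₂' : (Fintype.card (Fin n₂ × Fin R) : ℝ) ≤ Real.exp ℓ) :
    gaussianWidth (Γ • Kset n₁ n₂ R s₁ s₂) ≤
      Γ * (R * (6 * (L + 1) * (√R * √s₁ + √R * √s₂) * (√ℓ * (3 / 2 + Real.exp 4)))) := by
  obtain ⟨S, hS0, hSint, hSE, hS⟩ := exists_sign_form_bound hℓ h₁' h₂'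
  have : IsProbabilityMeasure (_root_.stdGaussian (Fin n₁ × Fin n₂)) := by
    rw [_root_.stdGaussian]; infer_instance
  refine (gaussianWidth_le_of_forall_le (zero_mem_smul_Kset _ _ _ _ _ _)
    (f := fun g => Γ * (R * (6 * (L + 1) * (√R * √s₁ + √R * √s₂) * (√ℓ * (3 / 2 + S g)))))
    ?_ fun g Z hZ => ?_).trans ?_
  · exact ((((integrable_const _).add hSint).const_mul _).const_mul _ |>.const_mul _).const_mul _
  · exact frob_smul_Kset_le hΓ hR hs₁ hs₂ (mul_nonneg (by positivity) (by linarith [hS0 g]))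
      h₁ h₂ g (hS g) hZ
  · rw [integral_const_mul, integral_const_mul, integral_const_mul, integral_const_mul,
      integral_add (integrable_const _) hSint]
    simp only [integral_const, probReal_univ, smul_eq_mul, one_mul]
    gcongr

lemma natLog_two_le (N : ℕ) (hN : 2 ≤ N) : 3 * ((Nat.log 2 N : ℝ) + 1) + 1 ≤ 11 * Real.log N := by
  have h1 : (1 : ℝ) ≤ Nat.log 2 N := by
    exact_mod_cast Nat.log_pos (by norm_num) hN
  have h2 : (Nat.log 2 N : ℝ) * Real.log 2 ≤ Real.log N := by
    rw [← Real.log_pow]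
    refine Real.log_le_log (by positivity) ?_
    exact_mod_cast Nat.pow_log_le_self 2 (by omega)
  have h3 := Real.log_two_gt_d9
  nlinarith

/-- Gaussian width of `Γ K_{s₁,s₂}^R`. -/
theorem gaussian_width_Kset :
    ∃ C : ℝ, 0 < C ∧
      ∀ (n₁ n₂ R : ℕ) (Γ s₁ s₂ : ℝ), 0 < Γ →
        1 ≤ s₁ → s₁ ≤ (n₁ : ℝ) → 1 ≤ s₂ → s₂ ≤ (n₂ : ℝ) → 2 ≤ n₁ → 2 ≤ n₂ →
        gaussianWidth (Γ • Kset n₁ n₂ R s₁ s₂) ≤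
          C * Real.sqrt (Γ ^ 2 * (R : ℝ) ^ 3 * (s₁ + s₂) *
            Real.log (max (n₁ : ℝ) (n₂ : ℝ)) ^ 3) := by
  refine ⟨1000 * (3 / 2 + Real.exp 4), by positivity, ?_⟩
  intro n₁ n₂ R Γ s₁ s₂ hΓ hs₁ _ hs₂ _ hn₁ hn₂
  set N := max n₁ n₂ with hNdef
  have hN : 2 ≤ N := hn₁.trans (le_max_left _ _)
  have hNcast : max (n₁ : ℝ) (n₂ : ℝ) = (N : ℝ) := by rw [hNdef, Nat.cast_max]
  rw [hNcast]
  have hN2 : (2 : ℝ) ≤ N := by exact_mod_cast hN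
  set l := Real.log N with hl
  have hl1 : 0.69 ≤ l := by
    have h := Real.log_le_log (by norm_num) hN2
    have := Real.log_two_gt_d9
    linarith
  have hl0 : 0 < l := by linarith
  have hsplit : √(Γ ^ 2 * (R : ℝ) ^ 3 * (s₁ + s₂) * l ^ 3) =
      Γ * (R * √R) * √(s₁ + s₂) * (l * √l) := by
    rw [Real.sqrt_eq_iff_mul_self_eq (by positivity) (by positivity), eq_comm]
    have e1 := Real.mul_self_sqrt (Nat.cast_nonneg (α := ℝ) R)
    have e2 := Real.mul_self_sqrt (show 0 ≤ s₁ + s₂ by linarith)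
    have e3 := Real.mul_self_sqrt hl0.le
    calc Γ * (R * √R) * √(s₁ + s₂) * (l * √l) * (Γ * (R * √R) * √(s₁ + s₂) * (l * √l))
        = Γ ^ 2 * R ^ 2 * (√R * √R) * (√(s₁ + s₂) * √(s₁ + s₂)) * l ^ 2 * (√l * √l) := by ring
      _ = _ := by rw [e1, e2, e3]; ring
  rw [hsplit]
  have hs : 1 ≤ √(s₁ + s₂) := Real.one_le_sqrt.2 (by linarith)
  have hE : 0 < Real.exp 4 := Real.exp_pos 4
  by_cases hR : 1 ≤ R ∧ R ≤ N ^ 2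
  · obtain ⟨hR1, hR2⟩ := hR
    have hcard : ∀ n ≤ N, Fintype.card (Fin n × Fin R) ≤ N ^ 3 := by
      intro n hn
      rw [Fintype.card_prod, Fintype.card_fin, Fintype.card_fin, pow_succ']
      exact Nat.mul_le_mul hn hR2
    have hpow : N ^ 3 ≤ 2 ^ (3 * (Nat.log 2 N + 1)) := by
      rw [mul_comm, pow_mul]
      exact Nat.pow_le_pow_left (Nat.lt_pow_succ_log_self (by norm_num) N).le 3
    have hexp : ((N ^ 3 : ℕ) : ℝ) = Real.exp (3 * l) := by
      rw [mul_comm, Real.exp_mul, hl, Real.exp_log (by linarith)]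
      norm_cast
    have c1 : ∀ n ≤ N, (Fintype.card (Fin n × Fin R) : ℝ) ≤ 2 ^ (3 * (Nat.log 2 N + 1)) :=
      fun n hn => by exact_mod_cast (hcard n hn).trans hpow
    have c2 : ∀ n ≤ N, (Fintype.card (Fin n × Fin R) : ℝ) ≤ Real.exp (3 * l) :=
      fun n hn => by rw [← hexp]; exact_mod_cast hcard n hn
    refine (gaussianWidth_smul_Kset_le_of_card_le (ℓ := 3 * l) hΓ hR1 hs₁ hs₂ (by linarith)
      (c1 _ (le_max_left _ _)) (c1 _ (le_max_right _ _)) (c2 _ (le_max_left _ _))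
      (c2 _ (le_max_right _ _))).trans ?_
    have hL := natLog_two_le N hN
    have hsum : √s₁ + √s₂ ≤ 2 * √(s₁ + s₂) := by
      have a1 : √s₁ ≤ √(s₁ + s₂) := Real.sqrt_le_sqrt (by linarith)
      have a2 : √s₂ ≤ √(s₁ + s₂) := Real.sqrt_le_sqrt (by linarith)
      linarith
    have hsl : √(3 * l) ≤ 2 * √l := by
      rw [Real.sqrt_le_left (by positivity), mul_pow, Real.sq_sqrt hl0.le]
      linarith
    push_cast
    calc Γ * (R * (6 * (3 * ((Nat.log 2 N : ℝ) + 1) + 1) * (√R * √s₁ + √R * √s₂) *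
          (√(3 * l) * (3 / 2 + Real.exp 4))))
        = Γ * (R * (6 * (3 * ((Nat.log 2 N : ℝ) + 1) + 1) * (√R * (√s₁ + √s₂)) *
          (√(3 * l) * (3 / 2 + Real.exp 4)))) := by ring
      _ ≤ Γ * (R * (6 * (11 * l) * (√R * (2 * √(s₁ + s₂))) *
          (2 * √l * (3 / 2 + Real.exp 4)))) := by gcongr
      _ = 264 * ((3 / 2 + Real.exp 4) * (Γ * (R * √R) * √(s₁ + s₂) * (l * √l))) := by ring
      _ ≤ 1000 * ((3 / 2 + Real.exp 4) * (Γ * (R * √R) * √(s₁ + s₂) * (l * √l))) := by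
          gcongr
          norm_num
      _ = _ := by ring
  · refine (gaussianWidth_smul_Kset_le_mul_max hΓ (by omega : 0 < N) (le_max_left _ _)
      (le_max_right _ _)).trans ?_
    have hRN : (R : ℝ) * N ≤ R * √R := by
      rcases Nat.eq_zero_or_pos R with h | h
      · simp [h]
      · have : N ^ 2 ≤ R := by
          by_contra hlt
          exact hR ⟨h, by omega⟩
        gcongr
        exact Real.le_sqrt_of_sq_le (by exact_mod_cast this)
    have hsl : 0.69 ≤ √l := Real.le_sqrt_of_sq_le (by norm_num at hl1 ⊢; linarith)
    have hll : 1 ≤ 1000 * (3 / 2 + Real.exp 4) * (l * √l) := by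
      have h1 : 0.69 * 0.69 ≤ l * √l := by gcongr
      have h2 : (1000 : ℝ) * (3 / 2) ≤ 1000 * (3 / 2 + Real.exp 4) := by linarith
      nlinarith
    calc Γ * (R * N) ≤ Γ * (R * √R) := by gcongr
      _ ≤ Γ * (R * √R) * (√(s₁ + s₂) * (1000 * (3 / 2 + Real.exp 4) * (l * √l))) :=
          le_mul_of_one_le_right (by positivity) (one_le_mul_of_one_le_of_one_le hs hll)
      _ = _ := by ring
end
end
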